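/- arXiv:1003.0775 — 2 statements merged into one kernel-verified Lean document; each statement's English description precedes it below -/
import Mathlib

section
/- Suppose b = 3 (i.e., m₀ = 3a + 3). Then the kernel E₃ of φ₃ : R₃ → R[t] equals the ideal of R₃ generated by the five polynomials L(0), L(1), B(1,1), B(1,2), B(2,2). In particular the Rees algebra R[℘t] is isomorphic to R₃/(L(0), L(1), B(1,1), B(1,2), B(2,2)). -/
noncomputable section

open MvPolynomial

abbrev Vb (b : ℕ) : Type := Fin 4 ⊕ Fin (4 - b) ⊕ Fin 3

abbrev Rb (K : Type) [Field K] (b : ℕ) : Type := MvPolynomial (Vb b) K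

abbrev R4 (K : Type) [Field K] : Type := MvPolynomial (Fin 4) K

def eps (i j : ℤ) : ℤ := if i + j < 3 then i + j else 3

variable (K : Type) [Field K] (a d b : ℕ)

/-- The variable `X_i` of `R_b`, with the convention `X_i = 0` for `i ∉ {0,1,2,3}`. -/
def Xv (i : ℤ) : Rb K b :=
  if h : 0 ≤ i ∧ i < 4 then X (Sum.inl ⟨i.toNat, by omega⟩) else 0

/-- The variable `Ψ(b,j)` of `R_b`, with the convention `Ψ(b,j) = 0` for `j ∉ {0,…,3-b}`. -/
def Psi (j : ℤ) : Rb K b :=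
  if h : 0 ≤ j ∧ j < 4 - (b : ℤ) then X (Sum.inr (Sum.inl ⟨j.toNat, by omega⟩)) else 0

/-- The variable `Φ(i,j)` of `R_b`, with `Φ(i,j) = Φ(j,i)` and `Φ(i,j) = 0` unless `i,j ∈ {1,2}`. -/
def Phi (i j : ℤ) : Rb K b :=
  if i = 1 ∧ j = 1 then X (Sum.inr (Sum.inr 2))
  else if (i = 1 ∧ j = 2) ∨ (i = 2 ∧ j = 1) then X (Sum.inr (Sum.inr 1))
  else if i = 2 ∧ j = 2 then X (Sum.inr (Sum.inr 0))
  else 0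

/-- `L(i) = X_iΦ(2,2) − X_{i+1}Φ(1,2) + X_{i+2}Φ(1,1)` for `i ∈ {0,1}`, `0` otherwise. -/
def Lp (i : ℤ) : Rb K b :=
  if i = 0 ∨ i = 1 then
    Xv K b i * Phi K b 2 2 - Xv K b (i + 1) * Phi K b 1 2 + Xv K b (i + 2) * Phi K b 1 1
  else 0

/-- `D = (X₁² − X₂X₀)Φ(1,2) − (X₁X₂ − X₃X₀)Φ(1,1)`. -/
def Dp : Rb K b :=
  (Xv K b 1 ^ 2 - Xv K b 2 * Xv K b 0) * Phi K b 1 2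
    - (Xv K b 1 * Xv K b 2 - Xv K b 3 * Xv K b 0) * Phi K b 1 1

/-- `B(i,j)`. -/
def Bp (i j : ℤ) : Rb K b :=
  (Xv K b i * Xv K b j - Xv K b (eps i j) * Xv K b (i + j - eps i j)) * Psi K b (3 - (b : ℤ))
    - (Xv K b 3 ^ a * Xv K b (b : ℤ) - Xv K b 0 ^ (a + d + 1)) * Phi K b i j

/-- `A(i;b,j)`. -/
def Ap (i j : ℤ) : Rb K b :=
  Xv K b i * Psi K b j
    - Xv K b ((b : ℤ) + i + j - eps i ((b : ℤ) + j)) * Psi K b (eps i ((b : ℤ) + j) - (b : ℤ))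
    - Xv K b 3 ^ a * Phi K b i ((b : ℤ) + j)
    + Xv K b 0 ^ (a + d) * (Phi K b i j - Phi K b ((b : ℤ) + i + j - 3) (3 - (b : ℤ)))

/-- `Q(b,i)`. -/
def Qp (i : ℕ) : Rb K b :=
  if b = 1 ∧ i = 1 then
    Psi K b 0 * Phi K b 2 2 + Psi K b 2 * Phi K b 1 1 - Psi K b 1 * Phi K b 1 2
  else if b = 1 ∧ i = 2 then
    Psi K b 1 ^ 2 - Psi K b 2 * Psi K b 0 - Xv K b 3 ^ (a - 1) * Psi K b 2 * Phi K b 2 2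
      + Xv K b 0 ^ (a + d - 1) * Psi K b 0 * Phi K b 1 1
      - Xv K b 3 ^ (a - 1) * Xv K b 0 ^ (a + d - 1) *
          (Phi K b 1 2 ^ 2 - Phi K b 2 2 * Phi K b 1 1)
  else if b = 2 ∧ i = 1 then
    Psi K b 0 ^ 2 * Phi K b 2 2 - Xv K b 3 ^ (a - 1) * Psi K b 1 * Phi K b 2 2 ^ 2
      - Psi K b 1 * Psi K b 0 * Phi K b 1 2
      - Xv K b 3 ^ (a - 1) * Xv K b 0 ^ (a + d - 1) * Phi K b 1 2 ^ 3
      + Psi K b 1 ^ 2 * Phi K b 1 1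
      + Xv K b 3 ^ (a - 1) * Xv K b 0 ^ (a + d - 1) * Phi K b 2 2 * Phi K b 1 2 * Phi K b 1 1
      + Xv K b 0 ^ (a + d - 1) * Psi K b 0 * Phi K b 1 1 ^ 2
  else 0

/-- `P(i,j) = tX_iX_j − tX_{ε(i,j)}X_{i+j−ε(i,j)} − Φ(i,j)` in `S = R_b[t]`. -/
def Pp (i j : ℤ) : Polynomial (Rb K b) :=
  Polynomial.X * Polynomial.C (Xv K b i * Xv K b j)
    - Polynomial.X * Polynomial.C (Xv K b (eps i j) * Xv K b (i + j - eps i j))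
    - Polynomial.C (Phi K b i j)

/-- `P(Ψ(b,l)) = tX_{b+l}X₃^a − tX_lX₀^{a+d} − Ψ(b,l)` in `S = R_b[t]`. -/
def PPsi (l : ℤ) : Polynomial (Rb K b) :=
  Polynomial.X * Polynomial.C (Xv K b ((b : ℤ) + l) * Xv K b 3 ^ a)
    - Polynomial.X * Polynomial.C (Xv K b l * Xv K b 0 ^ (a + d))
    - Polynomial.C (Psi K b l)

/-- The variable `X_i` of `R = K[X₀,X₁,X₂,X₃]`, with `X_i = 0` for `i ∉ {0,1,2,3}`. -/
def XR (i : ℤ) : R4 K :=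
  if h : 0 ≤ i ∧ i < 4 then X ⟨i.toNat, by omega⟩ else 0

/-- `φ(i,j) = X_iX_j − X_{ε(i,j)}X_{i+j−ε(i,j)}` for `i,j ∈ {1,2}`, `0` otherwise. -/
def phiR (i j : ℤ) : R4 K :=
  if (i = 1 ∨ i = 2) ∧ (j = 1 ∨ j = 2) then
    XR K i * XR K j - XR K (eps i j) * XR K (i + j - eps i j)
  else 0

/-- `ψ(b,j) = X_{b+j}X₃^a − X_jX₀^{a+d}` for `j ∈ {0,…,3-b}`, `0` otherwise. -/
def psiR (j : ℤ) : R4 K :=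
  if 0 ≤ j ∧ j ≤ 3 - (b : ℤ) then
    XR K ((b : ℤ) + j) * XR K 3 ^ a - XR K j * XR K 0 ^ (a + d)
  else 0

/-- `φ_b : R_b → R[t]`, `X_i ↦ X_i`, `Φ(i,j) ↦ φ(i,j)·t`, `Ψ(b,j) ↦ ψ(b,j)·t`. -/
def phib : Rb K b →ₐ[K] Polynomial (R4 K) :=
  aeval fun v =>
    match v with
    | Sum.inl i => Polynomial.C (X i)
    | Sum.inr (Sum.inl j) => Polynomial.C (psiR K a d b (j : ℤ)) * Polynomial.X
    | Sum.inr (Sum.inr k) =>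
        Polynomial.C (if k = 0 then phiR K 2 2 else if k = 1 then phiR K 1 2
          else phiR K 1 1) * Polynomial.X

/-- `η : R → K[T]`, `X_i ↦ T^{m_i}`. -/
def eta (m : Fin 4 → ℕ) : R4 K →ₐ[K] Polynomial K :=
  aeval fun i => Polynomial.X ^ (m i)



namespace KB3

lemma red_aux {A : Type*} [CommRing A] (x0 x1 x2 x3 : A) (h11 : x1 ^ 2 = x2 * x0)
    (h12 : x1 * x2 = x3 * x0) (h22 : x2 ^ 2 = x3 * x1) :
    ∀ n a0 a1 a2 a3 : ℕ, a1 + a2 ≤ n → ∃ b0 b1 b2 b3 : ℕ, b1 + b2 ≤ 1 ∧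
      3 * a0 + 2 * a1 + a2 = 3 * b0 + 2 * b1 + b2 ∧
      a1 + 2 * a2 + 3 * a3 = b1 + 2 * b2 + 3 * b3 ∧
      x0 ^ a0 * x1 ^ a1 * x2 ^ a2 * x3 ^ a3 = x0 ^ b0 * x1 ^ b1 * x2 ^ b2 * x3 ^ b3 := by
  intro n
  induction n with
  | zero => intro a0 a1 a2 a3 h; exact ⟨a0, a1, a2, a3, by omega, rfl, rfl, rfl⟩
  | succ n ih =>
    intro a0 a1 a2 a3 h
    by_cases h1 : a1 + a2 ≤ 1
    · exact ⟨a0, a1, a2, a3, h1, rfl, rfl, rfl⟩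
    by_cases h2 : 2 ≤ a1
    · obtain ⟨c, rfl⟩ := Nat.exists_eq_add_of_le h2
      obtain ⟨b0, b1, b2, b3, hb, e1, e2, e3⟩ := ih (a0 + 1) c (a2 + 1) a3 (by omega)
      refine ⟨b0, b1, b2, b3, hb, by omega, by omega, ?_⟩
      rw [← e3]
      linear_combination x0 ^ a0 * x1 ^ c * x2 ^ a2 * x3 ^ a3 * h11
    by_cases h3 : 2 ≤ a2
    · obtain ⟨c, rfl⟩ := Nat.exists_eq_add_of_le h3
      obtain ⟨b0, b1, b2, b3, hb, e1, e2, e3⟩ := ih a0 (a1 + 1) c (a3 + 1) (by omega)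
      refine ⟨b0, b1, b2, b3, hb, by omega, by omega, ?_⟩
      rw [← e3]
      linear_combination x0 ^ a0 * x1 ^ a1 * x2 ^ c * x3 ^ a3 * h22
    obtain rfl : a1 = 1 := by omega
    obtain rfl : a2 = 1 := by omega
    obtain ⟨b0, b1, b2, b3, hb, e1, e2, e3⟩ := ih (a0 + 1) 0 0 (a3 + 1) (by omega)
    refine ⟨b0, b1, b2, b3, hb, by omega, by omega, ?_⟩
    rw [← e3]
    linear_combination x0 ^ a0 * x3 ^ a3 * h12

/-- monomials with the same bidegree agree in the cone over the twisted cubic -/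
lemma bin_aux {A : Type*} [CommRing A] (x0 x1 x2 x3 : A) (h11 : x1 ^ 2 = x2 * x0)
    (h12 : x1 * x2 = x3 * x0) (h22 : x2 ^ 2 = x3 * x1) (a0 a1 a2 a3 c0 c1 c2 c3 : ℕ)
    (e1 : 3 * a0 + 2 * a1 + a2 = 3 * c0 + 2 * c1 + c2)
    (e2 : a1 + 2 * a2 + 3 * a3 = c1 + 2 * c2 + 3 * c3) :
    x0 ^ a0 * x1 ^ a1 * x2 ^ a2 * x3 ^ a3 = x0 ^ c0 * x1 ^ c1 * x2 ^ c2 * x3 ^ c3 := by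
  obtain ⟨b0, b1, b2, b3, hb, f1, f2, f3⟩ :=
    red_aux x0 x1 x2 x3 h11 h12 h22 _ a0 a1 a2 a3 le_rfl
  obtain ⟨b0', b1', b2', b3', hb', f1', f2', f3'⟩ :=
    red_aux x0 x1 x2 x3 h11 h12 h22 _ c0 c1 c2 c3 le_rfl
  rw [f3, f3']
  obtain rfl : b1 = b1' := by omega
  obtain rfl : b2 = b2' := by omega
  obtain rfl : b0 = b0' := by omega
  obtain rfl : b3 = b3' := by omega
  rfl

/-- Full reduction for the semigroup ring. -/
lemma red_eta {A : Type*} [CommRing A] (a d : ℕ) (x0 x1 x2 x3 : A) (h11 : x1 ^ 2 = x2 * x0)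
    (h12 : x1 * x2 = x3 * x0) (h22 : x2 ^ 2 = x3 * x1)
    (hψ : x3 ^ (a + 1) = x0 ^ (a + d + 1)) (a0 a1 a2 a3 : ℕ) :
    ∃ b0 b1 b2 b3 : ℕ, b1 + b2 ≤ 1 ∧ b3 ≤ a ∧
      (3 * a + 3) * (a0 + a1 + a2 + a3) + d * (a1 + 2 * a2 + 3 * a3) =
      (3 * a + 3) * (b0 + b1 + b2 + b3) + d * (b1 + 2 * b2 + 3 * b3) ∧
      x0 ^ a0 * x1 ^ a1 * x2 ^ a2 * x3 ^ a3 = x0 ^ b0 * x1 ^ b1 * x2 ^ b2 * x3 ^ b3 := by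
  obtain ⟨b0, b1, b2, b3, hb, f1, f2, f3⟩ :=
    red_aux x0 x1 x2 x3 h11 h12 h22 _ a0 a1 a2 a3 le_rfl
  have f4 : a0 + a1 + a2 + a3 = b0 + b1 + b2 + b3 := by omega
  rw [f3, f4, f2]
  clear f1 f2 f3 f4
  refine ⟨b0 + (a + d + 1) * (b3 / (a + 1)), b1, b2, b3 % (a + 1), hb,
    Nat.le_of_lt_succ (Nat.mod_lt _ (by omega)), ?_, ?_⟩
  · have h := Nat.div_add_mod b3 (a + 1)
    generalize b3 / (a + 1) = q at *
    generalize b3 % (a + 1) = r at *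
    subst h
    ring
  · conv_lhs => rw [← Nat.div_add_mod b3 (a + 1), pow_add, pow_mul, hψ]
    ring

lemma bin_eta {A : Type*} [CommRing A] (a d : ℕ) (hgcd : Nat.gcd (3 * a + 3) d = 1)
    (x0 x1 x2 x3 : A) (h11 : x1 ^ 2 = x2 * x0)
    (h12 : x1 * x2 = x3 * x0) (h22 : x2 ^ 2 = x3 * x1)
    (hψ : x3 ^ (a + 1) = x0 ^ (a + d + 1)) (a0 a1 a2 a3 c0 c1 c2 c3 : ℕ)
    (e : (3 * a + 3) * (a0 + a1 + a2 + a3) + d * (a1 + 2 * a2 + 3 * a3) =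
      (3 * a + 3) * (c0 + c1 + c2 + c3) + d * (c1 + 2 * c2 + 3 * c3)) :
    x0 ^ a0 * x1 ^ a1 * x2 ^ a2 * x3 ^ a3 = x0 ^ c0 * x1 ^ c1 * x2 ^ c2 * x3 ^ c3 := by
  obtain ⟨b0, b1, b2, b3, hb, f1, f2, f3⟩ :=
    red_eta a d x0 x1 x2 x3 h11 h12 h22 hψ a0 a1 a2 a3
  obtain ⟨b0', b1', b2', b3', hb', f1', f2', f3'⟩ :=
    red_eta a d x0 x1 x2 x3 h11 h12 h22 hψ c0 c1 c2 c3
  rw [f3, f3']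
  rw [f2, f2'] at e
  have hmod : d * (b1 + 2 * b2 + 3 * b3) ≡ d * (b1' + 2 * b2' + 3 * b3') [MOD (3 * a + 3)] := by
    have := congrArg (· % (3 * a + 3)) e
    simpa [Nat.ModEq, Nat.add_mod, Nat.mul_mod] using this
  have hmod2 := Nat.ModEq.cancel_left_of_coprime hgcd hmod
  have hlt : b1 + 2 * b2 + 3 * b3 < 3 * a + 3 := by omega
  have hlt' : b1' + 2 * b2' + 3 * b3' < 3 * a + 3 := by omega
  have key : b1 + 2 * b2 + 3 * b3 = b1' + 2 * b2' + 3 * b3' :=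
    Nat.ModEq.eq_of_lt_of_lt hmod2 hlt hlt'
  rw [key] at e
  have e' := Nat.eq_of_mul_eq_mul_left (by omega) (Nat.add_right_cancel e)
  obtain rfl : b1 = b1' := by omega
  obtain rfl : b2 = b2' := by omega
  obtain rfl : b3 = b3' := by omega
  obtain rfl : b0 = b0' := by omega
  rfl

/-- kernel of a monomial map -/
lemma ker_mono {σ ι B : Type*} [CommRing B] [Algebra K B] (κ : MvPolynomial σ K →ₐ[K] B)
    (I : Ideal (MvPolynomial σ K)) (w : (σ →₀ ℕ) → ι) (e : ι → B) (he : LinearIndependent K e)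
    (hκ : ∀ α, κ (monomial α 1) = e (w α))
    (hbin : ∀ α β, w α = w β →
      Ideal.Quotient.mk I (monomial α 1) = Ideal.Quotient.mk I (monomial β 1))
    (F : MvPolynomial σ K) (hF : κ F = 0) : F ∈ I := by
  classical
  let s : ι → (σ →₀ ℕ) := fun v => if h : ∃ α, w α = v then h.choose else 0
  have hs : ∀ α, w (s (w α)) = w α := by
    intro α
    have h : ∃ β, w β = w α := ⟨α, rfl⟩
    simp only [s, dif_pos h]
    exact h.choose_spec
  let T : MvPolynomial σ K →ₗ[K] (ι →₀ K) :=
    (basisMonomials σ K).constr K (fun α => Finsupp.single (w α) (1 : K))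
  have hT : ∀ α, T (monomial α 1) = Finsupp.single (w α) 1 := by
    intro α
    have := (basisMonomials σ K).constr_basis K (fun α => Finsupp.single (w α) (1 : K)) α
    simpa [T] using this
  have h1 : κ.toLinearMap = (Finsupp.linearCombination K e) ∘ₗ T := by
    apply (basisMonomials σ K).ext
    intro α
    simp [hT, hκ]
  have h2 : T F = 0 := by
    apply he
    have := LinearMap.congr_fun h1 F
    simp only [AlgHom.toLinearMap_apply, hF, LinearMap.comp_apply] at this
    rw [← this]; simp
  have h3 : (Ideal.Quotient.mkₐ K I).toLinearMap =
      (Ideal.Quotient.mkₐ K I).toLinearMap ∘ₗ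
      (Finsupp.linearCombination K (fun v => (monomial (s v) (1:K) : MvPolynomial σ K))) ∘ₗ T := by
    apply (basisMonomials σ K).ext
    intro α
    simp [hT]
    exact hbin _ _ (hs α).symm
  have h4 := LinearMap.congr_fun h3 F
  simp only [LinearMap.comp_apply, h2, map_zero] at h4
  exact Ideal.Quotient.eq_zero_iff_mem.mp h4

end KB3

namespace KB3

/-- `K[X₀,X₁,X₂,X₃,Φ(2,2),Φ(1,2),Φ(1,1)]` -/
abbrev S7 : Type := MvPolynomial (Fin 7) K

def l0 : S7 K := X 0 * X 4 - X 1 * X 5 + X 2 * X 6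
def l1 : S7 K := X 1 * X 4 - X 2 * X 5 + X 3 * X 6
def g11 : S7 K := X 1 ^ 2 - X 2 * X 0
def g12 : S7 K := X 1 * X 2 - X 3 * X 0
def g22 : S7 K := X 2 ^ 2 - X 3 * X 1

def Lid : Ideal (S7 K) := Ideal.span {l0 K, l1 K}

lemma sub_dvd (i : Fin 7) (ρ : S7 K →ₐ[K] S7 K) (hi : ρ (X i) = 0)
    (h : ∀ j, j ≠ i → ρ (X j) = X j) (p : S7 K) : ∃ q, p = ρ p + X i * q := by
  have h1 : (Ideal.Quotient.mkₐ K (Ideal.span {(X i : S7 K)})).comp ρ =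
      Ideal.Quotient.mkₐ K (Ideal.span {(X i : S7 K)}) := by
    apply MvPolynomial.algHom_ext
    intro j
    by_cases hj : j = i
    · subst hj
      simp only [AlgHom.comp_apply, hi, map_zero]
      symm
      exact Ideal.Quotient.eq_zero_iff_mem.mpr (Ideal.subset_span rfl)
    · simp only [AlgHom.comp_apply, h j hj]
  have h2 := AlgHom.congr_fun h1 p
  have h3 : p - ρ p ∈ Ideal.span {(X i : S7 K)} := Ideal.Quotient.eq.mp h2.symm
  obtain ⟨q, hq⟩ := Ideal.mem_span_singleton.mp h3
  exact ⟨q, by rw [← hq]; ring⟩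

lemma prime_l0' : Prime (X 0 * X 4 - X 1 * X 5 : S7 K) := by
  rw [← UniqueFactorizationMonoid.irreducible_iff_prime]
  have h := irreducible_mul_X_add (X 4 : S7 K) (-(X 1 * X 5)) 0 (X_ne_zero _)
    (by simp [vars_X]) (by
      rw [vars_neg]
      intro h
      have := vars_mul _ _ h
      simp [vars_X] at this) (by
      rw [Irreducible.isRelPrime_iff_not_dvd (MvPolynomial.X_prime).irreducible]
      rintro ⟨c, hc⟩
      have := congrArg (MvPolynomial.eval ![(0:K),1,0,0,0,1,0]) hc
      simp at this)
  have e : (X 0 * X 4 - X 1 * X 5 : S7 K) = X 4 * X 0 + -(X 1 * X 5) := by ring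
  rw [e]
  exact h

lemma nzd_phi (F : S7 K) (h : X 6 * F ∈ Lid K) : F ∈ Lid K := by
  obtain ⟨A, B, hAB⟩ := Ideal.mem_span_pair.mp h
  let ρ : S7 K →ₐ[K] S7 K := aeval ![X 0, X 1, X 2, X 3, X 4, X 5, 0]
  have hρi : ρ (X 6) = 0 := by simp [ρ]
  have hρ : ∀ j, j ≠ 6 → ρ (X j) = X j := by
    intro j hj
    fin_cases j <;> simp [ρ] at hj ⊢
  obtain ⟨A', hA⟩ := sub_dvd K 6 ρ hρi hρ A
  obtain ⟨B', hB⟩ := sub_dvd K 6 ρ hρi hρ B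
  have h0 : ρ (l0 K) = X 0 * X 4 - X 1 * X 5 := by simp [l0, ρ]
  have h1 : ρ (l1 K) = X 1 * X 4 - X 2 * X 5 := by simp [l1, ρ]
  have hz := congrArg ρ hAB
  simp only [map_add, map_mul, h0, h1, hρi, zero_mul] at hz
  have hp := prime_l0' K
  have hd : (X 0 * X 4 - X 1 * X 5 : S7 K) ∣ ρ B * (X 1 * X 4 - X 2 * X 5) :=
    ⟨-ρ A, by linear_combination hz⟩
  have hnd : ¬ (X 0 * X 4 - X 1 * X 5 : S7 K) ∣ (X 1 * X 4 - X 2 * X 5) := by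
    rintro ⟨c, hc⟩
    have := congrArg (MvPolynomial.eval ![(0:K),0,1,0,0,1,0]) hc
    simp at this
  obtain ⟨C, hC⟩ := (hp.dvd_or_dvd hd).resolve_right hnd
  have hAC : ρ A = - C * (X 1 * X 4 - X 2 * X 5) := by
    apply mul_left_cancel₀ hp.ne_zero
    rw [hC] at hz
    linear_combination hz
  refine Ideal.mem_span_pair.mpr ⟨A' + C * X 3, B' - C * X 2, ?_⟩
  apply mul_left_cancel₀ (X_ne_zero (R := K) (6 : Fin 7))
  rw [← hAB, hA, hB, hAC, hC]
  simp only [l0, l1]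
  ring

lemma nzd_phi_pow (n : ℕ) (F : S7 K) (h : X 6 ^ n * F ∈ Lid K) : F ∈ Lid K := by
  induction n with
  | zero => simpa using h
  | succ n ih => exact ih (nzd_phi K _ (by rw [← mul_assoc, ← pow_succ']; exact h))

/-- `S7 → R[t]` -/
def th : S7 K →ₐ[K] Polynomial (R4 K) :=
  aeval ![Polynomial.C (X 0), Polynomial.C (X 1), Polynomial.C (X 2), Polynomial.C (X 3),
    Polynomial.C (X 2 ^ 2 - X 3 * X 1) * Polynomial.X,
    Polynomial.C (X 1 * X 2 - X 3 * X 0) * Polynomial.X,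
    Polynomial.C (X 1 ^ 2 - X 2 * X 0) * Polynomial.X]

lemma th_l0 : th K (l0 K) = 0 := by
  simp [th, l0]; ring
lemma th_l1 : th K (l1 K) = 0 := by
  simp [th, l1]; ring

lemma th_Lid {F : S7 K} (h : F ∈ Lid K) : th K F = 0 := by
  obtain ⟨A, B, rfl⟩ := Ideal.mem_span_pair.mp h
  simp [th_l0, th_l1]

lemma exists_clear (θ : S7 K →ₐ[K] FractionRing (S7 K))
    (hθ : ∀ j : Fin 7, j ≠ 2 → j ≠ 3 → θ (X j) = algebraMap (S7 K) _ (X j)) (F : S7 K) :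
    ∃ n G, X 6 ^ n * F - G ∈ Lid K ∧ θ G = algebraMap _ _ G := by
  have hl0 : l0 K ∈ Lid K := Ideal.subset_span (by simp)
  have hl1 : l1 K ∈ Lid K := Ideal.subset_span (by simp)
  have h6 := hθ 6 (by decide) (by decide)
  induction F using MvPolynomial.induction_on with
  | C c => exact ⟨0, C c, by simp, by
      rw [← MvPolynomial.algebraMap_eq, AlgHom.commutes]
      exact IsScalarTower.algebraMap_apply _ _ _ _⟩
  | add p q hp hq =>
    obtain ⟨n, G, h1, h2⟩ := hp
    obtain ⟨n', G', h1', h2'⟩ := hq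
    refine ⟨n + n', X 6 ^ n' * G + X 6 ^ n * G', ?_, ?_⟩
    · have := (Lid K).add_mem ((Lid K).mul_mem_left (X 6 ^ n') h1)
        ((Lid K).mul_mem_left (X 6 ^ n) h1')
      convert this using 1; ring
    · simp only [map_add, map_mul, map_pow, h2, h2', h6]
  | mul_X p i hp =>
    obtain ⟨n, G, h1, h2⟩ := hp
    have key : ∃ n' G', X 6 ^ n' * X i - G' ∈ Lid K ∧ θ G' = algebraMap _ _ G' := by
      by_cases h2 : i = 2
      · subst h2
        refine ⟨1, X 1 * X 5 - X 0 * X 4, ?_, ?_⟩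
        · convert hl0 using 1; simp only [l0]; ring
        · simp [hθ]
      by_cases h3 : i = 3
      · subst h3
        refine ⟨2, (X 1 * X 5 - X 0 * X 4) * X 5 - X 6 * X 1 * X 4, ?_, ?_⟩
        · have := (Lid K).add_mem ((Lid K).mul_mem_left (X 6) hl1)
            ((Lid K).mul_mem_left (X 5) hl0)
          convert this using 1; simp only [l0, l1]; ring
        · simp [hθ]
      exact ⟨0, X i, by simp, hθ i h2 h3⟩
    obtain ⟨n', G', h1', h2'⟩ := key
    refine ⟨n + n', G * G', ?_, by simp [h2, h2']⟩
    have := (Lid K).add_mem ((Lid K).mul_mem_left (X 6 ^ n' * X i) h1)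
        ((Lid K).mul_mem_left G h1')
    convert this using 1; ring

/-- The twisted cubic ideal is of linear type. -/
lemma ker_th (F : S7 K) (h : th K F = 0) : F ∈ Lid K := by
  let D := FractionRing (S7 K)
  let ι : S7 K →+* D := algebraMap _ _
  have hι : Function.Injective ι := IsFractionRing.injective _ _
  let y : Fin 7 → D := fun i => ι (X i)
  have hy6 : y 6 ≠ 0 := by
    intro h0
    exact X_ne_zero (R := K) (6 : Fin 7) (hι (by simpa [y] using h0))
  let y2 : D := (y 1 * y 5 - y 0 * y 4) / y 6
  let y3 : D := (y2 * y 5 - y 1 * y 4) / y 6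
  have hy2 : y2 * y 6 = y 1 * y 5 - y 0 * y 4 := div_mul_cancel₀ _ hy6
  have hy3 : y3 * y 6 = y2 * y 5 - y 1 * y 4 := div_mul_cancel₀ _ hy6
  have hf : y 1 ^ 2 - y2 * y 0 ≠ 0 := by
    intro h0
    have h1 : ι (X 1 ^ 2 * X 6 - (X 1 * X 5 - X 0 * X 4) * X 0) = 0 := by
      have : y 1 ^ 2 * y 6 - (y 1 * y 5 - y 0 * y 4) * y 0 = 0 := by
        rw [← hy2]; linear_combination y 6 * h0
      simpa [y] using this
    have h2 := (map_eq_zero_iff ι hι).mp h1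
    have := congrArg (MvPolynomial.eval ![(0:K),1,0,0,0,0,1]) h2
    simp at this
  let t : D := y 6 / (y 1 ^ 2 - y2 * y 0)
  have ht : (y 1 ^ 2 - y2 * y 0) * t = y 6 := mul_div_cancel₀ _ hf
  let χ0 : R4 K →ₐ[K] D := aeval ![y 0, y 1, y2, y3]
  let χ : Polynomial (R4 K) →+* D := Polynomial.eval₂RingHom χ0.toRingHom t
  have hC : ∀ p, χ (Polynomial.C p) = χ0 p := by intro p; simp [χ]
  have hX : χ Polynomial.X = t := by simp [χ]
  let θ : S7 K →ₐ[K] D :=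
    { χ.comp (th K).toRingHom with
      commutes' := by
        intro r
        change χ (th K (algebraMap _ _ r)) = _
        rw [AlgHom.commutes]
        change χ (Polynomial.C (algebraMap _ _ r)) = _
        rw [hC, AlgHom.commutes] }
  have hθ : ∀ p, θ p = χ (th K p) := fun p => rfl
  have hθX : ∀ j : Fin 7, j ≠ 2 → j ≠ 3 → θ (X j) = algebraMap (S7 K) _ (X j) := by
    intro j h2 h3
    change θ (X j) = y j
    rw [hθ]
    fin_cases j
    · simp [th, hC, χ0]
    · simp [th, hC, χ0]
    · simp at h2
    · simp at h3
    · simp only [th, aeval_X]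
      simp [hC, hX, χ0]
      apply mul_right_cancel₀ hy6
      linear_combination (y2 * t) * hy2 - y 1 * t * hy3 + y 4 * ht
    · simp only [th, aeval_X]
      simp [hC, hX, χ0]
      apply mul_right_cancel₀ hy6
      linear_combination (y 1 * t) * hy2 - y 0 * t * hy3 + y 5 * ht
    · simp only [th, aeval_X]
      simp [hC, hX, χ0]
      exact ht
  obtain ⟨n, G, h1, h2⟩ := exists_clear K θ hθX F
  have h3 : th K G = 0 := by
    have := th_Lid K h1
    simpa [h] using this
  have h4 : G = 0 := by
    apply hι
    change algebraMap _ _ G = _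
    rw [← h2, hθ, h3]; simp
  rw [h4, sub_zero] at h1
  exact nzd_phi_pow K n F h1

end KB3

namespace KB3

/-- `K[s,u,Φ(2,2),Φ(1,2),Φ(1,1)]` -/
abbrev P5 : Type := MvPolynomial (Fin 5) K

def kap : S7 K →ₐ[K] P5 K :=
  aeval ![X 0 ^ 3, X 0 ^ 2 * X 1, X 0 * X 1 ^ 2, X 1 ^ 3, X 2, X 3, X 4]

def qq : P5 K := X 0 ^ 2 * X 2 - X 0 * X 1 * X 3 + X 1 ^ 2 * X 4

def Jid : Ideal (S7 K) := Ideal.span {g11 K, g12 K, g22 K}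
def Qid : Ideal (S7 K) := Lid K ⊔ Jid K

lemma kap_l0 : kap K (l0 K) = X 0 * qq K := by simp [kap, l0, qq]; ring
lemma kap_l1 : kap K (l1 K) = X 1 * qq K := by simp [kap, l1, qq]; ring
lemma kap_g11 : kap K (g11 K) = 0 := by simp [kap, g11]; ring
lemma kap_g12 : kap K (g12 K) = 0 := by simp [kap, g12]; ring
lemma kap_g22 : kap K (g22 K) = 0 := by simp [kap, g22]; ring

lemma kap_Jid {F : S7 K} (h : F ∈ Jid K) : kap K F = 0 := by
  have : Jid K ≤ RingHom.ker (kap K) := by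
    rw [Jid, Ideal.span_le]
    rintro x (rfl | rfl | rfl)
    · exact kap_g11 K
    · exact kap_g12 K
    · exact kap_g22 K
  exact this h

lemma monomial_eq_prod {n : ℕ} (α : Fin n →₀ ℕ) :
    (monomial α (1 : K)) = ∏ i, X i ^ α i := by
  rw [monomial_eq, C_1, one_mul, Finsupp.prod_fintype]
  simp

lemma li_mono {σ : Type*} :
    LinearIndependent K (fun v : σ →₀ ℕ => (monomial v (1 : K) : MvPolynomial σ K)) := by
  have := (basisMonomials σ K).linearIndependent
  simpa using this

lemma Jid_rel : 
    (Ideal.Quotient.mk (Jid K) (X 1)) ^ 2 =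
      Ideal.Quotient.mk (Jid K) (X 2) * Ideal.Quotient.mk (Jid K) (X 0) ∧
    (Ideal.Quotient.mk (Jid K) (X 1)) * Ideal.Quotient.mk (Jid K) (X 2) =
      Ideal.Quotient.mk (Jid K) (X 3) * Ideal.Quotient.mk (Jid K) (X 0) ∧
    (Ideal.Quotient.mk (Jid K) (X 2)) ^ 2 =
      Ideal.Quotient.mk (Jid K) (X 3) * Ideal.Quotient.mk (Jid K) (X 1) := by
  simp only [← map_pow, ← map_mul]
  refine ⟨Ideal.Quotient.eq.mpr (Ideal.subset_span ?_),
    Ideal.Quotient.eq.mpr (Ideal.subset_span ?_), Ideal.Quotient.eq.mpr (Ideal.subset_span ?_)⟩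
  · left; rfl
  · right; left; rfl
  · right; right; rfl

lemma ker_kap (F : S7 K) (h : kap K F = 0) : F ∈ Jid K := by
  refine ker_mono K (kap K) (Jid K)
    (fun α => (Finsupp.equivFunOnFinite.symm ![3 * α 0 + 2 * α 1 + α 2, α 1 + 2 * α 2 + 3 * α 3,
      α 4, α 5, α 6] : Fin 5 →₀ ℕ)) (fun v => monomial v 1) (li_mono K) ?_ ?_ F h
  · intro α
    rw [monomial_eq_prod, monomial_eq_prod]
    simp [Fin.prod_univ_succ, kap]
    ring
  · intro α β hαβ
    have hh : ∀ i, _ := fun i => DFunLike.congr_fun hαβ i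
    have e0 := hh 0
    have e1 := hh 1
    have e2 := hh 2
    have e3 := hh 3
    have e4 := hh 4
    simp at e0 e1 e2 e3 e4
    rw [monomial_eq_prod, monomial_eq_prod]
    simp only [Fin.prod_univ_seven, e2, e3, e4]
    simp only [map_mul, map_pow]
    obtain ⟨r1, r2, r3⟩ := Jid_rel K
    rw [bin_aux _ _ _ _ r1 r2 r3 (α 0) (α 1) (α 2) (α 3) (β 0) (β 1) (β 2) (β 3) e0 e1]

lemma mono_mem_range (v : Fin 5 →₀ ℕ) (hv : (v 0 + v 1) % 3 = 0) :
    ∃ p, kap K p = monomial v 1 := by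
  rw [monomial_eq_prod]
  have h0 := Nat.div_add_mod (v 0) 3
  have h1 := Nat.div_add_mod (v 1) 3
  have hlt : v 0 % 3 < 3 := Nat.mod_lt _ (by norm_num)
  simp only [Fin.prod_univ_five]
  generalize v 0 / 3 = i at *
  generalize v 1 / 3 = j at *
  generalize v 0 % 3 = r at *
  have : (r = 0 ∧ v 1 % 3 = 0) ∨ (r = 1 ∧ v 1 % 3 = 2) ∨ (r = 2 ∧ v 1 % 3 = 1) := by omega
  rw [← h0, ← h1]
  rcases this with ⟨rfl, h⟩ | ⟨rfl, h⟩ | ⟨rfl, h⟩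
  · refine ⟨X 0 ^ i * X 3 ^ j * X 4 ^ v 2 * X 5 ^ v 3 * X 6 ^ v 4, ?_⟩
    simp [kap, h]; ring
  · refine ⟨X 0 ^ i * X 2 * X 3 ^ j * X 4 ^ v 2 * X 5 ^ v 3 * X 6 ^ v 4, ?_⟩
    simp [kap, h]; ring
  · refine ⟨X 0 ^ i * X 1 * X 3 ^ j * X 4 ^ v 2 * X 5 ^ v 3 * X 6 ^ v 4, ?_⟩
    simp [kap, h]; ring

lemma mono_mem_range1 (v : Fin 5 →₀ ℕ) (hv : (v 0 + v 1) % 3 = 1) :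
    ∃ p p', X 0 * kap K p + X 1 * kap K p' = monomial v 1 := by
  by_cases h : 1 ≤ v 0
  · obtain ⟨p, hp⟩ := mono_mem_range K (v - Finsupp.single 0 1) (by simp; omega)
    refine ⟨p, 0, ?_⟩
    rw [hp, map_zero, mul_zero, add_zero, X, monomial_mul, mul_one, add_tsub_cancel_of_le]
    simpa using h
  · obtain ⟨p, hp⟩ := mono_mem_range K (v - Finsupp.single 1 1) (by simp; omega)
    refine ⟨0, p, ?_⟩
    rw [hp, map_zero, mul_zero, zero_add, X, monomial_mul, mul_one, add_tsub_cancel_of_le]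
    simp; omega

def w5 : Fin 5 → ZMod 3 := ![1, 1, 0, 0, 0]

lemma hom1_range (G : P5 K) (hG : IsWeightedHomogeneous w5 G 1) :
    ∃ p p', X 0 * kap K p + X 1 * kap K p' = G := by
  let M : Submodule K (P5 K) :=
    LinearMap.range ((LinearMap.mulLeft K (X 0 : P5 K)) ∘ₗ (kap K).toLinearMap) ⊔
    LinearMap.range ((LinearMap.mulLeft K (X 1 : P5 K)) ∘ₗ (kap K).toLinearMap)
  have hM : ∀ x, x ∈ M ↔ ∃ p p', X 0 * kap K p + X 1 * kap K p' = x := by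
    intro x
    simp [M, Submodule.mem_sup]
  rw [← hM, ← MvPolynomial.support_sum_monomial_coeff G]
  refine Submodule.sum_mem _ fun v hv => ?_
  have hw := hG (mem_support_iff.mp hv)
  rw [← mul_one (coeff v G), ← smul_eq_mul, ← smul_monomial]
  refine Submodule.smul_mem _ _ ((hM _).mpr (mono_mem_range1 K v ?_))
  rw [Finsupp.weight_apply, Finsupp.sum_fintype _ _ (by simp)] at hw
  simp [Fin.sum_univ_five, w5] at hw
  have h2 : ((v 0 + v 1 : ℕ) : ZMod 3) = ((1 : ℕ) : ZMod 3) := by simpa using hw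
  exact (ZMod.natCast_eq_natCast_iff' _ _ _).mp h2

lemma qq_hom : IsWeightedHomogeneous w5 (qq K) 2 := by
  have hX := fun i => isWeightedHomogeneous_X K w5 i
  have h1 := ((hX 0).pow 2).mul (hX 2)
  have h2 := ((hX 0).mul (hX 1)).mul (hX 3)
  have h3 := ((hX 1).pow 2).mul (hX 4)
  refine IsWeightedHomogeneous.add (IsWeightedHomogeneous.sub ?_ ?_) ?_
  · exact (by decide : 2 • w5 0 + w5 2 = 2) ▸ h1
  · exact (by decide : w5 0 + w5 1 + w5 3 = 2) ▸ h2
  · exact (by decide : 2 • w5 1 + w5 4 = 2) ▸ h3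

lemma kap_hom (F : S7 K) : IsWeightedHomogeneous w5 (kap K F) 0 := by
  have hX := fun i => isWeightedHomogeneous_X K w5 i
  induction F using MvPolynomial.induction_on with
  | C c =>
    rw [← MvPolynomial.algebraMap_eq, AlgHom.commutes, MvPolynomial.algebraMap_eq]
    exact isWeightedHomogeneous_C _ _
  | add p q hp hq => rw [map_add]; exact hp.add hq
  | mul_X p i hp =>
    rw [map_mul, ← add_zero (0 : ZMod 3)]
    refine hp.mul ?_
    simp only [kap, aeval_X]
    fin_cases i
    · have := ((hX 0).pow 3)
      exact (by decide : 3 • w5 0 = 0) ▸ this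
    · have := ((hX 0).pow 2).mul (hX 1)
      exact (by decide : 2 • w5 0 + w5 1 = 0) ▸ this
    · have := (hX 0).mul ((hX 1).pow 2)
      exact (by decide : w5 0 + 2 • w5 1 = 0) ▸ this
    · have := ((hX 1).pow 3)
      exact (by decide : 3 • w5 1 = 0) ▸ this
    · exact hX 2
    · exact hX 3
    · exact hX 4

lemma mem_Qid_of_dvd (F : S7 K) (h : qq K ∣ kap K F) : F ∈ Qid K := by
  obtain ⟨G, hG⟩ := h
  let _ := weightedGradedAlgebra K w5
  have h1 := DirectSum.coe_decompose_mul_add_of_left_mem (weightedHomogeneousSubmodule K w5)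
    (i := 2) (j := 1) (a := qq K) (b := G) (qq_hom K)
  rw [← hG] at h1
  have h2 := DirectSum.decompose_of_mem_same (weightedHomogeneousSubmodule K w5) (kap_hom K F)
  have h3 : (2 : ZMod 3) + 1 = 0 := by decide
  rw [h3, h2] at h1
  obtain ⟨p, p', hp⟩ := hom1_range K _
    ((DirectSum.decompose (weightedHomogeneousSubmodule K w5) G 1).2)
  have h4 : kap K (F - (l0 K * p + l1 K * p')) = 0 := by
    rw [map_sub, h1, ← hp, map_add, map_mul, map_mul, kap_l0, kap_l1]
    ring
  have h5 := ker_kap K _ h4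
  have h6 : l0 K * p + l1 K * p' ∈ Lid K :=
    Ideal.mem_span_pair.mpr ⟨p, p', by ring⟩
  have := Ideal.add_mem (Qid K) (Ideal.mem_sup_right h5 : _ ∈ Qid K)
    (Ideal.mem_sup_left h6 : _ ∈ Qid K)
  simpa using this

lemma dvd_of_mem_Qid (F : S7 K) (h : F ∈ Qid K) : qq K ∣ kap K F := by
  obtain ⟨x, hx, y, hy, rfl⟩ := Submodule.mem_sup.mp h
  obtain ⟨A, B, rfl⟩ := Ideal.mem_span_pair.mp hx
  rw [map_add, kap_Jid K hy, map_add, map_mul, map_mul, kap_l0, kap_l1]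
  exact ⟨kap K A * X 0 + kap K B * X 1, by ring⟩

lemma prime_qq : Prime (qq K) := by
  rw [← UniqueFactorizationMonoid.irreducible_iff_prime]
  have h := irreducible_mul_X_add (X 0 ^ 2 : P5 K) (X 1 ^ 2 * X 4 - X 0 * X 1 * X 3) 2
    (pow_ne_zero _ (X_ne_zero _))
    (by
      intro h
      have := vars_pow _ _ h
      simp [vars_X] at this) (by
      intro h
      have h := vars_sub_subset _ h
      rw [Finset.mem_union] at h
      rcases h with h | h
      · have h := vars_mul _ _ h
        rw [Finset.mem_union] at h
        rcases h with h | h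
        · have := vars_pow _ _ h
          simp [vars_X] at this
        · simp [vars_X] at h
      · have h := vars_mul _ _ h
        rw [Finset.mem_union] at h
        rcases h with h | h
        · have := vars_mul _ _ h
          simp [vars_X] at this
        · simp [vars_X] at h) (by
      apply IsRelPrime.pow_left
      rw [Irreducible.isRelPrime_iff_not_dvd (MvPolynomial.X_prime).irreducible]
      rintro ⟨c, hc⟩
      have := congrArg (MvPolynomial.eval ![(0:K),1,0,0,1]) hc
      simp at this)
  have e : qq K = X 0 ^ 2 * X 2 + (X 1 ^ 2 * X 4 - X 0 * X 1 * X 3) := by simp only [qq]; ring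
  rw [e]
  exact h

def psi7 (a d : ℕ) : S7 K := X 3 ^ (a + 1) - X 0 ^ (a + d + 1)

lemma nzd_psi (a d : ℕ) (F : S7 K) (h : psi7 K a d * F ∈ Qid K) : F ∈ Qid K := by
  have h1 := dvd_of_mem_Qid K _ h
  rw [map_mul] at h1
  refine mem_Qid_of_dvd K _ (((prime_qq K).dvd_or_dvd h1).resolve_left ?_)
  rintro ⟨c, hc⟩
  have := congrArg (MvPolynomial.eval ![(0:K),1,0,0,0]) hc
  simp [kap, psi7, qq] at this

end KB3

namespace KB3

def f11 : R4 K := X 1 ^ 2 - X 2 * X 0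
def f12 : R4 K := X 1 * X 2 - X 3 * X 0
def f22 : R4 K := X 2 ^ 2 - X 3 * X 1
def psi4 (a d : ℕ) : R4 K := X 3 ^ (a + 1) - X 0 ^ (a + d + 1)

def J4 : Ideal (R4 K) := Ideal.span {f11 K, f12 K, f22 K}

def emb : R4 K →ₐ[K] S7 K := aeval ![X 0, X 1, X 2, X 3]

lemma th_emb (r : R4 K) : th K (emb K r) = Polynomial.C r := by
  have : (th K).comp (emb K) = (Algebra.ofId (R4 K) (Polynomial (R4 K))).restrictScalars K := by
    apply MvPolynomial.algHom_ext
    intro i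
    fin_cases i <;> simp [th, emb]
  exact AlgHom.congr_fun this r

lemma emb_f11 : emb K (f11 K) = g11 K := by simp [emb, f11, g11]
lemma emb_f12 : emb K (f12 K) = g12 K := by simp [emb, f12, g12]
lemma emb_f22 : emb K (f22 K) = g22 K := by simp [emb, f22, g22]
lemma emb_psi (a d : ℕ) : emb K (psi4 K a d) = psi7 K a d := by simp [emb, psi4, psi7]

lemma th_X4 : th K (X 4) = Polynomial.C (f22 K) * Polynomial.X := by simp [th, f22]
lemma th_X5 : th K (X 5) = Polynomial.C (f12 K) * Polynomial.X := by simp [th, f12]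
lemma th_X6 : th K (X 6) = Polynomial.C (f11 K) * Polynomial.X := by simp [th, f11]

lemma f11_mem : f11 K ∈ J4 K := Ideal.subset_span (by simp)
lemma f12_mem : f12 K ∈ J4 K := Ideal.subset_span (by simp)
lemma f22_mem : f22 K ∈ J4 K := Ideal.subset_span (by simp)

lemma mem_triple {A : Type*} [CommRing A] {x y z p : A} (h : p ∈ Ideal.span {x, y, z}) :
    ∃ a b c, p = a * x + b * y + c * z := by
  obtain ⟨a, q, hq, rfl⟩ := Ideal.mem_span_insert.mp h
  obtain ⟨b, c, rfl⟩ := Ideal.mem_span_pair.mp hq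
  exact ⟨a, b, c, by ring⟩

lemma th_mem_rees (F : S7 K) : th K F ∈ reesAlgebra (J4 K) := by
  have hm : ∀ r ∈ J4 K, Polynomial.C r * Polynomial.X ∈ reesAlgebra (J4 K) := by
    intro r hr
    rw [Polynomial.C_mul_X_eq_monomial, reesAlgebra.monomial_mem, pow_one]
    exact hr
  have hc : ∀ r : R4 K, Polynomial.C r ∈ reesAlgebra (J4 K) := by
    intro r
    exact (reesAlgebra (J4 K)).algebraMap_mem r
  induction F using MvPolynomial.induction_on with
  | C c =>
    rw [← MvPolynomial.algebraMap_eq, AlgHom.commutes]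
    exact hc (algebraMap _ _ c)
  | add p q hp hq => rw [map_add]; exact Subalgebra.add_mem _ hp hq
  | mul_X p i hp =>
    rw [map_mul]
    refine Subalgebra.mul_mem _ hp ?_
    fin_cases i
    · simpa [th] using hc (X 0)
    · simpa [th] using hc (X 1)
    · simpa [th] using hc (X 2)
    · simpa [th] using hc (X 3)
    · exact th_X4 K ▸ hm _ (f22_mem K)
    · exact th_X5 K ▸ hm _ (f12_mem K)
    · exact th_X6 K ▸ hm _ (f11_mem K)

lemma rees_le_range (p : Polynomial (R4 K)) (hp : p ∈ reesAlgebra (J4 K)) :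
    ∃ F, th K F = p := by
  rw [← adjoin_monomial_eq_reesAlgebra] at hp
  induction hp using Algebra.adjoin_induction with
  | mem x hx =>
    obtain ⟨r, hr, rfl⟩ := hx
    obtain ⟨a, b, c, rfl⟩ := mem_triple hr
    refine ⟨emb K a * X 6 + emb K b * X 5 + emb K c * X 4, ?_⟩
    rw [← Polynomial.C_mul_X_eq_monomial]
    simp only [map_add, map_mul, th_emb, th_X4, th_X5, th_X6]
    ring
  | algebraMap r => exact ⟨emb K r, th_emb K r⟩
  | add x y _ _ hx hy =>
    obtain ⟨F, rfl⟩ := hx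
    obtain ⟨G, rfl⟩ := hy
    exact ⟨F + G, map_add _ _ _⟩
  | mul x y _ _ hx hy =>
    obtain ⟨F, rfl⟩ := hx
    obtain ⟨G, rfl⟩ := hy
    exact ⟨F * G, map_mul _ _ _⟩

lemma emb_J {r : R4 K} (hr : r ∈ J4 K) : emb K r ∈ Jid K := by
  obtain ⟨a, b, c, rfl⟩ := mem_triple hr
  simp only [map_add, map_mul, emb_f11, emb_f12, emb_f22]
  refine Ideal.add_mem _ (Ideal.add_mem _ ?_ ?_) ?_ <;>
    exact Ideal.mul_mem_left _ _ (Ideal.subset_span (by simp))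

lemma mono_range (k : ℕ) (c : R4 K) (hc : c ∈ J4 K ^ (k + 1)) :
    ∃ H ∈ Jid K, th K H = Polynomial.monomial k c := by
  rw [pow_succ'] at hc
  induction hc using Submodule.mul_induction_on' with
  | mem_mul_mem r hr s hs =>
    obtain ⟨F, hF⟩ := rees_le_range K (Polynomial.monomial k s) (reesAlgebra.monomial_mem.mpr hs)
    refine ⟨emb K r * F, Ideal.mul_mem_right _ _ (emb_J K hr), ?_⟩
    rw [map_mul, hF, th_emb, Polynomial.C_mul_monomial]
  | add x _ y _ hx hy =>
    obtain ⟨F, hF, hF'⟩ := hx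
    obtain ⟨G, hG, hG'⟩ := hy
    exact ⟨F + G, Ideal.add_mem _ hF hG, by rw [map_add, hF', hG', map_add]⟩

lemma range_J (p : Polynomial (R4 K)) (hp : ∀ k, p.coeff k ∈ J4 K ^ (k + 1)) :
    ∃ H ∈ Jid K, th K H = p := by
  choose H hH hH' using fun k => mono_range K k _ (hp k)
  refine ⟨∑ k ∈ p.support, H k, Ideal.sum_mem _ fun k _ => hH k, ?_⟩
  rw [map_sum]
  simp only [hH']
  exact (Polynomial.as_sum_support p).symm

lemma coeff_th_J {B : S7 K} (hB : B ∈ Jid K) (k : ℕ) : (th K B).coeff k ∈ J4 K ^ (k + 1) := by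
  have hf : ∀ r ∈ J4 K, ∀ F, (th K (F * emb K r)).coeff k ∈ J4 K ^ (k + 1) := by
    intro r hr F
    rw [map_mul, th_emb, Polynomial.coeff_mul_C, pow_succ]
    exact Ideal.mul_mem_mul ((mem_reesAlgebra_iff _ _).mp (th_mem_rees K F) k) hr
  obtain ⟨a, b, c, rfl⟩ := mem_triple hB
  rw [← emb_f11, ← emb_f12, ← emb_f22, map_add, map_add, Polynomial.coeff_add,
    Polynomial.coeff_add]
  exact Ideal.add_mem _ (Ideal.add_mem _ (hf _ (f11_mem K) _) (hf _ (f12_mem K) _))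
    (hf _ (f22_mem K) _)

/-- `ψ` is a nonzerodivisor modulo all powers of the twisted cubic ideal. -/
lemma nzd_pow (a d : ℕ) : ∀ (n : ℕ) (g : R4 K), psi4 K a d * g ∈ J4 K ^ n → g ∈ J4 K ^ n := by
  intro n
  induction n with
  | zero => intro g _; simp
  | succ n ih =>
    intro g hg
    have hg0 : g ∈ J4 K ^ n := ih g (Ideal.pow_le_pow_right (Nat.le_succ n) hg)
    obtain ⟨G, hG⟩ := rees_le_range K (Polynomial.monomial n g) (reesAlgebra.monomial_mem.mpr hg0)
    obtain ⟨H, hH, hH'⟩ := mono_range K n _ hg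
    have h1 : th K (psi7 K a d * G - H) = 0 := by
      rw [map_sub, map_mul, ← emb_psi, th_emb, hG, hH', Polynomial.C_mul_monomial, sub_self]
    have h2 := ker_th K _ h1
    have h3 : psi7 K a d * G ∈ Qid K := by
      have := Ideal.add_mem (Qid K) (Ideal.mem_sup_left h2 : _ ∈ Qid K)
        (Ideal.mem_sup_right hH : _ ∈ Qid K)
      simpa using this
    obtain ⟨A, hA, B, hB, rfl⟩ := Submodule.mem_sup.mp (nzd_psi K a d G h3)
    rw [map_add, th_Lid K hA, zero_add] at hG
    have h5 := coeff_th_J K hB n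
    rw [hG] at h5
    simpa using h5

/-- The inclusion `S7 → R₃`. -/
def i7 : S7 K →ₐ[K] Rb K 3 :=
  aeval ![X (Sum.inl 0), X (Sum.inl 1), X (Sum.inl 2), X (Sum.inl 3),
    X (Sum.inr (Sum.inr 0)), X (Sum.inr (Sum.inr 1)), X (Sum.inr (Sum.inr 2))]

def PP : Rb K 3 := X (Sum.inr (Sum.inl 0))

lemma phib_inl (a d : ℕ) (i : Fin 4) :
    phib K a d 3 (X (Sum.inl i)) = Polynomial.C (X i) := by simp [phib]

lemma phib_0 (a d : ℕ) : phib K a d 3 (X (Sum.inr (Sum.inr 0))) =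
    Polynomial.C (f22 K) * Polynomial.X := by
  simp [phib, phiR, XR, eps, f22]; ring
lemma phib_1 (a d : ℕ) : phib K a d 3 (X (Sum.inr (Sum.inr 1))) =
    Polynomial.C (f12 K) * Polynomial.X := by
  simp [phib, phiR, XR, eps, f12]
lemma phib_2 (a d : ℕ) : phib K a d 3 (X (Sum.inr (Sum.inr 2))) =
    Polynomial.C (f11 K) * Polynomial.X := by
  simp [phib, phiR, XR, eps, f11]; ring
lemma phib_PP (a d : ℕ) : phib K a d 3 (PP K) =
    Polynomial.C (psi4 K a d) * Polynomial.X := by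
  simp [phib, psiR, XR, psi4, PP]; ring

lemma phib_i7 (a d : ℕ) (F : S7 K) : phib K a d 3 (i7 K F) = th K F := by
  have : (phib K a d 3).comp (i7 K) = th K := by
    apply MvPolynomial.algHom_ext
    intro i
    rw [AlgHom.comp_apply]
    fin_cases i
    · simp [i7, th]; exact phib_inl K a d 0
    · simp [i7, th]; exact phib_inl K a d 1
    · simp [i7, th]; exact phib_inl K a d 2
    · simp [i7, th]; exact phib_inl K a d 3
    · refine Eq.trans ?_ (th_X4 K).symm
      simp [i7]; exact phib_0 K a d
    · refine Eq.trans ?_ (th_X5 K).symm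
      simp [i7]; exact phib_1 K a d
    · refine Eq.trans ?_ (th_X6 K).symm
      simp [i7]; exact phib_2 K a d
  exact AlgHom.congr_fun this F

def I5 (a d : ℕ) : Ideal (Rb K 3) :=
  Ideal.span {Lp K 3 0, Lp K 3 1, Bp K a d 3 1 1, Bp K a d 3 1 2, Bp K a d 3 2 2}

lemma Lp0_eq : Lp K 3 0 = i7 K (l0 K) := by
  simp [Lp, Xv, Phi, i7, l0]
lemma Lp1_eq : Lp K 3 1 = i7 K (l1 K) := by
  simp [Lp, Xv, Phi, i7, l1]
lemma Bp11_eq (a d : ℕ) : Bp K a d 3 1 1 =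
    i7 K (g11 K) * PP K - i7 K (psi7 K a d) * i7 K (X 6) := by
  simp [Bp, Xv, Phi, Psi, i7, g11, psi7, PP, eps]; ring
lemma Bp12_eq (a d : ℕ) : Bp K a d 3 1 2 =
    i7 K (g12 K) * PP K - i7 K (psi7 K a d) * i7 K (X 5) := by
  simp [Bp, Xv, Phi, Psi, i7, g12, psi7, PP, eps]; ring
lemma Bp22_eq (a d : ℕ) : Bp K a d 3 2 2 =
    i7 K (g22 K) * PP K - i7 K (psi7 K a d) * i7 K (X 4) := by
  simp [Bp, Xv, Phi, Psi, i7, g22, psi7, PP, eps]; ring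

lemma I5_le_ker (a d : ℕ) : I5 K a d ≤ RingHom.ker (phib K a d 3) := by
  rw [I5, Ideal.span_le]
  have e := th_emb K
  rintro x (rfl | rfl | rfl | rfl | rfl) <;> change phib K a d 3 _ = 0
  · rw [Lp0_eq, phib_i7, th_l0]
  · rw [Lp1_eq, phib_i7, th_l1]
  · rw [Bp11_eq, map_sub, map_mul, map_mul, phib_i7, phib_i7, phib_i7, phib_PP, th_X6,
      ← emb_f11, ← emb_psi, e, e]; ring
  · rw [Bp12_eq, map_sub, map_mul, map_mul, phib_i7, phib_i7, phib_i7, phib_PP, th_X5,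
      ← emb_f12, ← emb_psi, e, e]; ring
  · rw [Bp22_eq, map_sub, map_mul, map_mul, phib_i7, phib_i7, phib_i7, phib_PP, th_X4,
      ← emb_f22, ← emb_psi, e, e]; ring

lemma i7_Lid (a d : ℕ) {F : S7 K} (h : F ∈ Lid K) : i7 K F ∈ I5 K a d := by
  obtain ⟨A, B, rfl⟩ := Ideal.mem_span_pair.mp h
  rw [map_add, map_mul, map_mul, ← Lp0_eq, ← Lp1_eq]
  exact Ideal.add_mem _ (Ideal.mul_mem_left _ _ (Ideal.subset_span (by simp)))
    (Ideal.mul_mem_left _ _ (Ideal.subset_span (by simp)))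

lemma i7_Jid (a d : ℕ) {H : S7 K} (h : H ∈ Jid K) :
    ∃ H', i7 K H * PP K - i7 K (psi7 K a d * H') ∈ I5 K a d := by
  obtain ⟨A, B, C, rfl⟩ := mem_triple h
  refine ⟨A * X 6 + B * X 5 + C * X 4, ?_⟩
  have h1 : Bp K a d 3 1 1 ∈ I5 K a d := Ideal.subset_span (by simp)
  have h2 : Bp K a d 3 1 2 ∈ I5 K a d := Ideal.subset_span (by simp)
  have h3 : Bp K a d 3 2 2 ∈ I5 K a d := Ideal.subset_span (by simp)
  have := Ideal.add_mem _ (Ideal.add_mem _ (Ideal.mul_mem_left _ (i7 K A) h1)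
    (Ideal.mul_mem_left _ (i7 K B) h2)) (Ideal.mul_mem_left _ (i7 K C) h3)
  convert this using 1
  rw [Bp11_eq, Bp12_eq, Bp22_eq]
  simp only [map_add, map_mul]
  ring

def evP : Polynomial (S7 K) →+* Rb K 3 := Polynomial.eval₂RingHom (i7 K).toRingHom (PP K)

lemma evP_C (c : S7 K) : evP K (Polynomial.C c) = i7 K c := by simp [evP]
lemma evP_X : evP K Polynomial.X = PP K := by simp [evP]

lemma evP_surj (F : Rb K 3) : ∃ p, evP K p = F := by
  induction F using MvPolynomial.induction_on with
  | C c =>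
    refine ⟨Polynomial.C (C c), ?_⟩
    rw [evP_C, ← MvPolynomial.algebraMap_eq, AlgHom.commutes]; rfl
  | add p q hp hq =>
    obtain ⟨p, rfl⟩ := hp
    obtain ⟨q, rfl⟩ := hq
    exact ⟨p + q, map_add _ _ _⟩
  | mul_X p i hp =>
    obtain ⟨p, rfl⟩ := hp
    have : ∃ q, evP K q = X i := by
      rcases i with i | i | i
      · fin_cases i
        · exact ⟨Polynomial.C (X 0), by rw [evP_C]; simp [i7]⟩
        · exact ⟨Polynomial.C (X 1), by rw [evP_C]; simp [i7]⟩
        · exact ⟨Polynomial.C (X 2), by rw [evP_C]; simp [i7]⟩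
        · exact ⟨Polynomial.C (X 3), by rw [evP_C]; simp [i7]⟩
      · fin_cases i
        exact ⟨Polynomial.X, evP_X K⟩
      · fin_cases i
        · exact ⟨Polynomial.C (X 4), by rw [evP_C]; simp [i7]⟩
        · exact ⟨Polynomial.C (X 5), by rw [evP_C]; simp [i7]⟩
        · exact ⟨Polynomial.C (X 6), by rw [evP_C]; simp [i7]⟩
    obtain ⟨q, hq⟩ := this
    exact ⟨p * q, by rw [map_mul, hq]⟩

lemma main_ker (a d : ℕ) : ∀ (n : ℕ) (p : Polynomial (S7 K)), p.natDegree ≤ n →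
    phib K a d 3 (evP K p) = 0 → evP K p ∈ I5 K a d := by
  intro n
  induction n with
  | zero =>
    intro p hp h
    rw [Polynomial.eq_C_of_natDegree_le_zero hp, evP_C] at h ⊢
    rw [phib_i7] at h
    exact i7_Lid K a d (ker_th K _ h)
  | succ n ih =>
    intro p hp h
    have hdec := Polynomial.divX_mul_X_add p
    have hdeg : p.divX.natDegree ≤ n := by
      rw [Polynomial.natDegree_divX_eq_natDegree_tsub_one]; omega
    generalize p.divX = p1 at *
    generalize p.coeff 0 = c at *
    subst hdec
    have hsplit : evP K (p1 * Polynomial.X + Polynomial.C c) = evP K p1 * PP K + i7 K c := by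
      rw [map_add, map_mul, evP_C, evP_X]
    rw [hsplit] at h ⊢
    have h' := h
    rw [map_add, map_mul, phib_PP, phib_i7] at h
    have hy : ∀ k, (phib K a d 3 (evP K p1)).coeff k ∈ J4 K ^ (k + 1) := by
      intro k
      apply nzd_pow K a d
      have h1 := congrArg (fun q => Polynomial.coeff q (k + 1)) h
      simp only [Polynomial.coeff_add, ← mul_assoc, Polynomial.coeff_mul_X,
        Polynomial.coeff_mul_C, Polynomial.coeff_zero] at h1
      have h2 := (mem_reesAlgebra_iff _ _).mp (th_mem_rees K c) (k + 1)
      have h3 : psi4 K a d * (phib K a d 3 (evP K p1)).coeff k = -(th K c).coeff (k + 1) := by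
        linear_combination h1
      rw [h3]
      exact (Ideal.neg_mem_iff _).mpr h2
    obtain ⟨H, hH, hH'⟩ := range_J K _ hy
    have h2 := ih (p1 - Polynomial.C H)
      ((Polynomial.natDegree_sub_le _ _).trans (by simpa using hdeg))
      (by rw [map_sub, map_sub, evP_C, phib_i7, hH', sub_self])
    rw [map_sub, evP_C] at h2
    obtain ⟨H', h3⟩ := i7_Jid K a d hH
    have h4 : (evP K p1 * PP K + i7 K c) - i7 K (psi7 K a d * H' + c) ∈ I5 K a d := by
      have := Ideal.add_mem _ (Ideal.mul_mem_right (PP K) _ h2) h3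
      convert this using 1
      rw [map_add]; ring
    have h5 : th K (psi7 K a d * H' + c) = 0 := by
      have : phib K a d 3 _ = 0 := I5_le_ker K a d h4
      rw [map_sub, h', phib_i7, zero_sub, neg_eq_zero] at this
      exact this
    have := Ideal.add_mem _ h4 (i7_Lid K a d (ker_th K _ h5))
    rwa [sub_add_cancel] at this

lemma ker_phib (a d : ℕ) : RingHom.ker (phib K a d 3) = I5 K a d := by
  apply le_antisymm _ (I5_le_ker K a d)
  intro F hF
  obtain ⟨p, rfl⟩ := evP_surj K F
  exact main_ker K a d _ p le_rfl hF

def I4 (a d : ℕ) : Ideal (R4 K) := Ideal.span {psi4 K a d, f11 K, f12 K, f22 K}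

lemma eta_f (a d : ℕ) (m : Fin 4 → ℕ) (hm : ∀ i : Fin 4, m i = 3 * a + 3 + (i : ℕ) * d) :
    I4 K a d ≤ RingHom.ker (eta K m) := by
  rw [I4, Ideal.span_le]
  have h0 := hm 0
  have h1 := hm 1
  have h2 := hm 2
  have h3 := hm 3
  simp at h0 h1 h2 h3
  rintro x (rfl | rfl | rfl | rfl) <;> change eta K m _ = 0
  · simp [eta, psi4, h0, h3]; ring
  · simp [eta, f11, h0, h1, h2]; ring
  · simp [eta, f12, h0, h1, h2, h3]; ring
  · simp [eta, f22, h1, h2, h3]; ring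

lemma ker_eta (a d : ℕ) (m : Fin 4 → ℕ) (hm : ∀ i : Fin 4, m i = 3 * a + 3 + (i : ℕ) * d)
    (hgcd : Nat.gcd (3 * a + 3) d = 1) (F : R4 K) (h : eta K m F = 0) : F ∈ I4 K a d := by
  have h0 := hm 0
  have h1 := hm 1
  have h2 := hm 2
  have h3 := hm 3
  simp at h0 h1 h2 h3
  refine ker_mono K (eta K m) (I4 K a d)
    (fun α => (3 * a + 3) * (α 0 + α 1 + α 2 + α 3) + d * (α 1 + 2 * α 2 + 3 * α 3))
    (fun n => (Polynomial.X ^ n : Polynomial K)) ?_ ?_ ?_ F h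
  · have := (Polynomial.basisMonomials K).linearIndependent
    simpa [Polynomial.coe_basisMonomials, Polynomial.monomial_one_right_eq_X_pow] using this
  · intro α
    rw [monomial_eq_prod]
    simp only [Fin.prod_univ_four, map_mul, map_pow, eta, aeval_X, ← pow_mul, ← pow_add,
      h0, h1, h2, h3]
    congr 1
    ring
  · intro α β hαβ
    rw [monomial_eq_prod, monomial_eq_prod]
    simp only [Fin.prod_univ_four, map_mul, map_pow]
    apply bin_eta a d hgcd
    · rw [← map_pow, ← map_mul]
      exact Ideal.Quotient.eq.mpr (Ideal.subset_span (by simp [f11]))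
    · rw [← map_mul, ← map_mul]
      exact Ideal.Quotient.eq.mpr (Ideal.subset_span (by simp [f12]))
    · rw [← map_pow, ← map_mul]
      exact Ideal.Quotient.eq.mpr (Ideal.subset_span (by simp [f22]))
    · rw [← map_pow, ← map_pow]
      exact Ideal.Quotient.eq.mpr (Ideal.subset_span (by simp [psi4]))
    · exact hαβ

def ReesP (m : Fin 4 → ℕ) : Subalgebra (R4 K) (Polynomial (R4 K)) :=
  Algebra.adjoin (R4 K)
          {f : Polynomial (R4 K) | ∃ p ∈ RingHom.ker (eta K m),
            f = Polynomial.C p * Polynomial.X}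

lemma phib_mem (a d : ℕ) (m : Fin 4 → ℕ) (hm : ∀ i : Fin 4, m i = 3 * a + 3 + (i : ℕ) * d)
    (F : Rb K 3) : phib K a d 3 F ∈ ReesP K m := by
  have hc : ∀ r : R4 K, Polynomial.C r ∈ ReesP K m := fun r => (ReesP K m).algebraMap_mem r
  have hg : ∀ r ∈ I4 K a d, Polynomial.C r * Polynomial.X ∈ ReesP K m := fun r hr =>
    Algebra.subset_adjoin ⟨r, eta_f K a d m hm hr, rfl⟩
  induction F using MvPolynomial.induction_on with
  | C c =>
    rw [← MvPolynomial.algebraMap_eq, AlgHom.commutes]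
    exact hc (algebraMap _ _ c)
  | add p q hp hq => rw [map_add]; exact Subalgebra.add_mem _ hp hq
  | mul_X p i hp =>
    rw [map_mul]
    refine Subalgebra.mul_mem _ hp ?_
    rcases i with i | i | i
    · rw [phib_inl]; exact hc _
    · fin_cases i
      exact phib_PP K a d ▸ hg _ (Ideal.subset_span (by simp))
    · fin_cases i
      · exact phib_0 K a d ▸ hg _ (Ideal.subset_span (by simp))
      · exact phib_1 K a d ▸ hg _ (Ideal.subset_span (by simp))
      · exact phib_2 K a d ▸ hg _ (Ideal.subset_span (by simp))

lemma phib_surj (a d : ℕ) (m : Fin 4 → ℕ) (hm : ∀ i : Fin 4, m i = 3 * a + 3 + (i : ℕ) * d)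
    (hgcd : Nat.gcd (3 * a + 3) d = 1) (x : Polynomial (R4 K)) (hx : x ∈ ReesP K m) :
    ∃ F, phib K a d 3 F = x := by
  induction hx using Algebra.adjoin_induction with
  | mem x hx =>
    obtain ⟨r, hr, rfl⟩ := hx
    obtain ⟨e, q, hq, rfl⟩ := Ideal.mem_span_insert.mp (ker_eta K a d m hm hgcd r hr)
    obtain ⟨a', b', c', rfl⟩ := mem_triple hq
    refine ⟨i7 K (emb K e) * PP K +
      i7 K (emb K a' * X 6 + emb K b' * X 5 + emb K c' * X 4), ?_⟩
    rw [map_add, map_mul, phib_i7, phib_i7, phib_PP]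
    simp only [map_add, map_mul, th_emb, th_X4, th_X5, th_X6]
    ring
  | algebraMap r => exact ⟨i7 K (emb K r), by rw [phib_i7]; exact th_emb K r⟩
  | add x y _ _ hx hy =>
    obtain ⟨F, rfl⟩ := hx
    obtain ⟨G, rfl⟩ := hy
    exact ⟨F + G, map_add _ _ _⟩
  | mul x y _ _ hx hy =>
    obtain ⟨F, rfl⟩ := hx
    obtain ⟨G, rfl⟩ := hy
    exact ⟨F * G, map_mul _ _ _⟩

lemma equiv_exists (a d : ℕ) (m : Fin 4 → ℕ) (hm : ∀ i : Fin 4, m i = 3 * a + 3 + (i : ℕ) * d)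
    (hgcd : Nat.gcd (3 * a + 3) d = 1) :
    Nonempty ((Rb K 3 ⧸ I5 K a d) ≃ₐ[K] (ReesP K m)) := by
  let f : Rb K 3 →ₐ[K] (ReesP K m) :=
    (phib K a d 3).codRestrict ((ReesP K m).restrictScalars K) (phib_mem K a d m hm)
  have hf : ∀ F, ((f F : ReesP K m) : Polynomial (R4 K)) = phib K a d 3 F := fun F => rfl
  have hs : Function.Surjective f := by
    rintro ⟨x, hx⟩
    obtain ⟨F, hF⟩ := phib_surj K a d m hm hgcd x hx
    exact ⟨F, Subtype.ext hF⟩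
  have hk : I5 K a d = RingHom.ker f := by
    rw [← ker_phib]
    ext F
    rw [RingHom.mem_ker, RingHom.mem_ker, Subtype.ext_iff, hf]
    rfl
  exact ⟨(Ideal.quotientEquivAlgOfEq K hk).trans (Ideal.quotientKerAlgEquivOfSurjective hs)⟩

end KB3
/-- Suppose `b = 3` (i.e. `m₀ = 3a + 3`).  Then `E₃ = ker φ₃` equals the ideal
generated by `L(0)`, `L(1)`, `B(1,1)`, `B(1,2)`, `B(2,2)`; in particular the Rees algebra
`R[℘t]` is isomorphic to `R₃` modulo this ideal. -/
theorem kernel_b_three (K : Type) [Field K] (a d : ℕ) (m : Fin 4 → ℕ)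
    (hm : ∀ i : Fin 4, m i = 3 * a + 3 + (i : ℕ) * d)
    (ha : 1 ≤ a) (hd : 1 ≤ d)
    (hgcd : Nat.gcd (3 * a + 3) d = 1)
    (hmin : ∀ i : Fin 4, m i ∉ AddSubmonoid.closure {x : ℕ | ∃ j : Fin 4, j ≠ i ∧ x = m j}) :
    RingHom.ker (phib K a d 3) =
      Ideal.span {Lp K 3 0, Lp K 3 1, Bp K a d 3 1 1, Bp K a d 3 1 2, Bp K a d 3 2 2} ∧
    Nonempty
      ((Rb K 3 ⧸ Ideal.span {Lp K 3 0, Lp K 3 1, Bp K a d 3 1 1, Bp K a d 3 1 2, Bp K a d 3 2 2})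
        ≃ₐ[K] (Algebra.adjoin (R4 K)
          {f : Polynomial (R4 K) | ∃ p ∈ RingHom.ker (eta K m),
            f = Polynomial.C p * Polynomial.X})) := by
  exact ⟨KB3.ker_phib K a d, KB3.equiv_exists K a d m hm hgcd⟩
end
end

section
/- For b ∈ {1,2}, the kernel E_b of φ_b : R_b → R[t] is generated by the smaller set {A(i;b,j) : i ∈ {1,2,3}, j ∈ {0,…,2−b}} ∪ {L(0), L(1), D} together with {Q(1,1), Q(1,2)} when b = 1, respectively {Q(2,1)} when b = 2 (i.e., the generators B(i,j) are redundant). -/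
noncomputable section

open MvPolynomial

variable (K : Type) [Field K] (a d b : ℕ)

/-- The smaller generating set `{A(i;b,j)} ∪ {L(0), L(1), D}` together with the `Q`'s. -/
def smallGenSet : Set (Rb K b) :=
  {x | ∃ i ∈ ({1, 2, 3} : Set ℤ), ∃ j : ℕ, j ≤ 2 - b ∧ x = Ap K a d b i (j : ℤ)} ∪
    {Lp K b 0, Lp K b 1, Dp K b} ∪
    (if b = 1 then {Qp K a d b 1, Qp K a d b 2} else {Qp K a d b 1})

section Helpers

/-- The quadric-type form `ℓ = σ²r − στq + τ²p` in `K[σ,τ,p,q,r]`. -/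
def ell : MvPolynomial (Fin 5) K := X 0 ^ 2 * X 4 - X 0 * X 1 * X 3 + X 1 ^ 2 * X 2

lemma ell_reduce (F : MvPolynomial (Fin 5) K) : ∃ (m : ℕ) (F0 : MvPolynomial (Fin 4) K),
    ell K ∣ X 0 ^ m * F - rename Fin.castSucc F0 := by
  induction F using MvPolynomial.induction_on with
  | C c => exact ⟨0, C c, by simp⟩
  | add F G hF hG =>
    obtain ⟨m, F0, u, hu⟩ := hF
    obtain ⟨n, G0, v, hv⟩ := hG
    refine ⟨m + n, X 0 ^ n * F0 + X 0 ^ m * G0, X 0 ^ n * u + X 0 ^ m * v, ?_⟩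
    simp only [map_add, map_mul, map_pow, rename_X, Fin.castSucc_zero]
    linear_combination X 0 ^ n * hu + X 0 ^ m * hv
  | mul_X F i hF =>
    obtain ⟨m, F0, u, hu⟩ := hF
    induction i using Fin.lastCases with
    | cast i =>
      refine ⟨m, F0 * X i, u * X i.castSucc, ?_⟩
      simp only [map_mul, rename_X]
      linear_combination X i.castSucc * hu
    | last =>
      refine ⟨m + 2, F0 * (X 0 * X 1 * X 3 - X 1 ^ 2 * X 2),
        u * X 0 ^ 2 * X 4 + rename Fin.castSucc F0, ?_⟩
      have h4 : (Fin.last 4 : Fin 5) = 4 := rfl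
      have e0 : (Fin.castSucc (0 : Fin 4)) = 0 := rfl
      have e1 : (Fin.castSucc (1 : Fin 4)) = 1 := rfl
      have e2 : (Fin.castSucc (2 : Fin 4)) = 2 := rfl
      have e3 : (Fin.castSucc (3 : Fin 4)) = 3 := rfl
      simp only [map_mul, map_sub, map_pow, rename_X, h4, e0, e1, e2, e3]
      unfold ell at hu ⊢
      linear_combination X 0 ^ 2 * X 4 * hu

lemma X_not_dvd_of_eval {n : ℕ} (i : Fin n) (F : MvPolynomial (Fin n) K) (v : Fin n → K)
    (hi : v i = 0) (hF : eval v F ≠ 0) : ¬ X i ∣ F := by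
  rintro ⟨G, rfl⟩
  simp [hi] at hF

lemma ell_dvd_of_theta {L : Type} [Field L] [Algebra K L] (pt : Fin 4 → L)
    (hinj : Function.Injective (aeval (R := K) pt)) (F : MvPolynomial (Fin 5) K) (r : L)
    (hr : pt 0 ^ 2 * r = pt 0 * pt 1 * pt 3 - pt 1 ^ 2 * pt 2)
    (hF : aeval (R := K) (![pt 0, pt 1, pt 2, pt 3, r] : Fin 5 → L) F = 0) : ell K ∣ F := by
  obtain ⟨m, F0, u, hu⟩ := ell_reduce K F
  have hF0 : F0 = 0 := by
    apply hinj
    have h := congrArg (aeval (R := K) (![pt 0, pt 1, pt 2, pt 3, r] : Fin 5 → L)) hu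
    have hl : aeval (R := K) (![pt 0, pt 1, pt 2, pt 3, r] : Fin 5 → L) (ell K) = 0 := by
      simp only [ell, map_add, map_sub, map_mul, map_pow, aeval_X]
      simp only [Matrix.cons_val]
      linear_combination hr
    simp only [map_sub, map_mul, hF, hl, mul_zero, zero_mul, zero_sub, aeval_rename] at h
    rw [map_zero]
    have hc : ((![pt 0, pt 1, pt 2, pt 3, r] : Fin 5 → L) ∘ Fin.castSucc) = pt := by
      funext i; fin_cases i <;> rfl
    rw [hc] at h
    simpa using h
  rw [hF0, map_zero, sub_zero] at hu
  have hp : Prime (X 0 : MvPolynomial (Fin 5) K) := X_prime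
  have hnd : ¬ (X 0 : MvPolynomial (Fin 5) K) ∣ ell K := by
    apply X_not_dvd_of_eval K 0 (ell K) ![0, 1, 1, 0, 0] rfl
    simp [ell]
  obtain ⟨G, rfl⟩ := hp.pow_dvd_of_dvd_mul_left m hnd (Dvd.intro _ hu)
  refine ⟨G, ?_⟩
  have h0 : (X 0 : MvPolynomial (Fin 5) K) ^ m ≠ 0 := pow_ne_zero _ hp.ne_zero
  apply mul_left_cancel₀ h0
  linear_combination hu

/-- The ideal `(L(0), L(1))` in `K[w,x,y,z,p,q,r]`. -/
def IL : Ideal (MvPolynomial (Fin 7) K) :=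
  Ideal.span {X 0 * X 6 - X 1 * X 5 + X 2 * X 4, X 1 * X 6 - X 2 * X 5 + X 3 * X 4}

lemma prime_l0 : Prime (X 0 * X 6 - X 1 * X 5 : MvPolynomial (Fin 7) K) := by
  rw [← irreducible_iff_prime, sub_eq_add_neg]
  apply MvPolynomial.irreducible_mul_X_add
  · exact X_ne_zero _
  · simp [vars_X]
  · intro h
    have := vars_mul _ _ (by simpa [vars_neg] using h : (6 : Fin 7) ∈ (X 1 * X 5 : MvPolynomial (Fin 7) K).vars)
    simp [vars_X] at this
  · have hp : Prime (X 0 : MvPolynomial (Fin 7) K) := X_prime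
    refine (hp.irreducible.isRelPrime_iff_not_dvd).2 ?_
    apply X_not_dvd_of_eval K 0 _ ![0, 1, 0, 0, 0, 1, 0] rfl
    simp

/-- Setting `p = 0`. -/
def killp : MvPolynomial (Fin 7) K →ₐ[K] MvPolynomial (Fin 7) K :=
  aeval fun i => if i = 4 then 0 else X i

lemma dvd_sub_killp (g : MvPolynomial (Fin 7) K) : X 4 ∣ g - killp K g := by
  induction g using MvPolynomial.induction_on with
  | C c => simp [killp, algebraMap_eq]
  | add f g hf hg =>
    rw [map_add]; convert dvd_add hf hg using 1; ring
  | mul_X f i hf =>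
    rw [map_mul]
    obtain ⟨u, hu⟩ := hf
    by_cases hi : i = 4
    · subst hi; simp [killp]
    · have : killp K (X i) = X i := by simp [killp, hi]
      rw [this]; exact ⟨u * X i, by linear_combination X i * hu⟩

lemma IL_cancel (g : MvPolynomial (Fin 7) K) (h : X 4 * g ∈ IL K) : g ∈ IL K := by
  unfold IL at h ⊢
  rw [Ideal.mem_span_pair] at h ⊢
  obtain ⟨u, v, h⟩ := h
  have hk := congrArg (killp K) h
  have k4 : killp K (X 4) = 0 := by simp [killp]
  have kk : ∀ i : Fin 7, i ≠ 4 → killp K (X i) = X i := by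
    intro i hi; simp [killp, hi]
  simp only [map_add, map_sub, map_mul, k4, kk 0 (by decide), kk 1 (by decide), kk 2 (by decide),
    kk 3 (by decide), kk 5 (by decide), kk 6 (by decide), mul_zero, zero_mul, add_zero] at hk
  have hdv : (X 0 * X 6 - X 1 * X 5 : MvPolynomial (Fin 7) K) ∣
      killp K v * (X 1 * X 6 - X 2 * X 5) := ⟨-killp K u, by linear_combination hk⟩
  rcases (prime_l0 K).dvd_or_dvd hdv with ⟨c, hc⟩ | ⟨c, hc⟩
  · obtain ⟨u', hu'⟩ := dvd_sub_killp K u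
    obtain ⟨v', hv'⟩ := dvd_sub_killp K v
    have hku : killp K u = - c * (X 1 * X 6 - X 2 * X 5) := by
      apply mul_right_cancel₀ (prime_l0 K).ne_zero
      rw [hc] at hk
      linear_combination hk
    refine ⟨u' + c * X 3, v' - c * X 2, ?_⟩
    apply mul_left_cancel₀ (X_ne_zero (R := K) (4 : Fin 7))
    rw [← h]
    rw [hku] at hu'
    rw [hc] at hv'
    linear_combination -(X 0 * X 6 - X 1 * X 5 + X 2 * X 4) * hu'
      - (X 1 * X 6 - X 2 * X 5 + X 3 * X 4) * hv'
  · exfalso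
    have := congrArg (eval (![0, 1, 0, 0, 0, 0, 1] : Fin 7 → K)) hc
    simp at this

lemma IL_cancel_pow (m : ℕ) (g : MvPolynomial (Fin 7) K) (h : X 4 ^ m * g ∈ IL K) :
    g ∈ IL K := by
  induction m with
  | zero => simpa using h
  | succ m ih => exact ih (IL_cancel K _ (by convert h using 1; ring))

/-- The inclusion `K[w,x,p,q,r] → K[w,x,y,z,p,q,r]`. -/
def j57 : MvPolynomial (Fin 5) K →ₐ[K] MvPolynomial (Fin 7) K :=
  aeval ![X 0, X 1, X 4, X 5, X 6]

lemma IL_reduce (F : MvPolynomial (Fin 7) K) : ∃ (m : ℕ) (F0 : MvPolynomial (Fin 5) K),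
    X 4 ^ m * F - j57 K F0 ∈ IL K := by
  have hL0 : (X 0 * X 6 - X 1 * X 5 + X 2 * X 4 : MvPolynomial (Fin 7) K) ∈ IL K :=
    Ideal.subset_span (by simp)
  have hL1 : (X 1 * X 6 - X 2 * X 5 + X 3 * X 4 : MvPolynomial (Fin 7) K) ∈ IL K :=
    Ideal.subset_span (by simp)
  have jX : ∀ i : Fin 5, j57 K (X i) = ![X 0, X 1, X 4, X 5, X 6] i := by
    intro i; simp [j57]
  induction F using MvPolynomial.induction_on with
  | C c => exact ⟨0, C c, by simp [j57, algebraMap_eq]⟩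
  | add F G hF hG =>
    obtain ⟨m, F0, hu⟩ := hF
    obtain ⟨n, G0, hv⟩ := hG
    refine ⟨m + n, X 2 ^ n * F0 + X 2 ^ m * G0, ?_⟩
    convert add_mem (Ideal.mul_mem_left _ (X 4 ^ n) hu) (Ideal.mul_mem_left _ (X 4 ^ m) hv) using 1
    simp only [map_add, map_mul, map_pow, jX, Matrix.cons_val]
    ring
  | mul_X F i hF =>
    obtain ⟨m, F0, hu⟩ := hF
    have key : ∀ (c : MvPolynomial (Fin 7) K) (k : ℕ) (G0 : MvPolynomial (Fin 5) K),
        X 4 ^ k * c - j57 K G0 ∈ IL K →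
        ∃ (m : ℕ) (F0 : MvPolynomial (Fin 5) K), X 4 ^ m * (F * c) - j57 K F0 ∈ IL K := by
      intro c k G0 hc
      refine ⟨m + k, F0 * G0, ?_⟩
      convert add_mem (Ideal.mul_mem_left _ (X 4 ^ k * c) hu) (Ideal.mul_mem_left _ (j57 K F0) hc) using 1
      simp only [map_mul]
      ring
    have key0 : ∀ i : Fin 5, ∃ (m : ℕ) (F0 : MvPolynomial (Fin 5) K),
        X 4 ^ m * (F * j57 K (X i)) - j57 K F0 ∈ IL K := by
      intro i
      exact key _ 0 (X i) (by simp)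
    simp only [jX] at key0
    fin_cases i
    · exact key0 0
    · exact key0 1
    · refine key (X 2) 1 (X 1 * X 3 - X 0 * X 4) ?_
      convert hL0 using 1
      simp only [map_sub, map_mul, jX, Matrix.cons_val]
      ring
    · refine key (X 3) 2 ((X 1 * X 3 - X 0 * X 4) * X 3 - X 1 * X 4 * X 2) ?_
      convert add_mem (Ideal.mul_mem_left _ (X 5) hL0) (Ideal.mul_mem_left _ (X 4) hL1) using 1
      simp only [map_sub, map_mul, jX, Matrix.cons_val]
      ring
    · exact key0 2
    · exact key0 3
    · exact key0 4

lemma mem_IL_of_eval {L : Type} [Field L] [Algebra K L] (pt : Fin 7 → L)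
    (hinj : Function.Injective (aeval (R := K) (![pt 0, pt 1, pt 4, pt 5, pt 6] : Fin 5 → L)))
    (h0 : pt 0 * pt 6 - pt 1 * pt 5 + pt 2 * pt 4 = 0)
    (h1 : pt 1 * pt 6 - pt 2 * pt 5 + pt 3 * pt 4 = 0)
    (F : MvPolynomial (Fin 7) K) (hF : aeval (R := K) pt F = 0) : F ∈ IL K := by
  obtain ⟨m, F0, hu⟩ := IL_reduce K F
  have hker : IL K ≤ RingHom.ker (aeval (R := K) pt) := by
    unfold IL
    rw [Ideal.span_le]
    rintro f (rfl | rfl)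
    · simpa [RingHom.mem_ker] using h0
    · simpa [RingHom.mem_ker] using h1
  have h := hker hu
  rw [RingHom.mem_ker, map_sub, map_mul, hF, mul_zero, zero_sub, neg_eq_zero] at h
  have hc : (aeval (R := K) pt).comp (j57 K) =
      aeval (R := K) (![pt 0, pt 1, pt 4, pt 5, pt 6] : Fin 5 → L) := by
    ext i; fin_cases i <;> simp [j57]
  have hF0 : F0 = 0 := by
    apply hinj
    rw [← hc, map_zero]; exact h
  rw [hF0, map_zero, sub_zero] at hu
  exact IL_cancel_pow K m F hu

end Helpers

section Filtration

/-- The number of `Ψ` variables in a monomial. -/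
def wt (m : Vb b →₀ ℕ) : ℕ := ∑ j, m (Sum.inr (Sum.inl j))

lemma wt_add (m n : Vb b →₀ ℕ) : wt b (m + n) = wt b m + wt b n := by
  simp [wt, Finset.sum_add_distrib]

/-- Polynomials of `Ψ`-degree less than `N`. -/
def FF (N : ℕ) : Submodule K (Rb K b) :=
  Submodule.span K {g | ∃ m, wt b m < N ∧ g = monomial m 1}

/-- The ideal `I` plus polynomials of `Ψ`-degree less than `N`. -/
def WW (I : Ideal (Rb K b)) (N : ℕ) : Submodule K (Rb K b) := I.restrictScalars K ⊔ FF K b N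

/-- Multiplication by `r` raises the `Ψ`-degree by at most `k`. -/
def HH (k : ℕ) (r : Rb K b) : Prop :=
  ∀ (I : Ideal (Rb K b)) (M : ℕ) (g : Rb K b), g ∈ WW K b I M → r * g ∈ WW K b I (M + k)

variable {K b}

lemma mem_WW_of_mem {I : Ideal (Rb K b)} {N : ℕ} {g : Rb K b} (h : g ∈ I) : g ∈ WW K b I N :=
  Submodule.mem_sup_left h

lemma mem_WW_of_FF {I : Ideal (Rb K b)} {N : ℕ} {g : Rb K b} (h : g ∈ FF K b N) :
    g ∈ WW K b I N := Submodule.mem_sup_right h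

lemma WW_cast {I : Ideal (Rb K b)} {M N : ℕ} {g : Rb K b} (h : M = N) (hg : g ∈ WW K b I M) :
    g ∈ WW K b I N := h ▸ hg

lemma HH_monomial (m : Vb b →₀ ℕ) : HH K b (wt b m) (monomial m 1) := by
  intro I M g hg
  obtain ⟨x, hx, y, hy, rfl⟩ := Submodule.mem_sup.1 hg
  rw [mul_add]
  refine add_mem (mem_WW_of_mem (I.mul_mem_left _ hx)) (mem_WW_of_FF ?_)
  clear hg hx
  unfold FF at hy ⊢
  induction hy using Submodule.span_induction with
  | mem y hy =>
    obtain ⟨n, hn, rfl⟩ := hy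
    refine Submodule.subset_span ⟨m + n, ?_, ?_⟩
    · rw [wt_add]; omega
    · rw [monomial_mul, one_mul]
  | zero => simp
  | add x y _ _ hx hy => rw [mul_add]; exact add_mem hx hy
  | smul c x _ hx => rw [mul_smul_comm]; exact Submodule.smul_mem _ _ hx

lemma HH_zero (k : ℕ) : HH K b k 0 := by
  intro I M g _; simp

lemma HH_one : HH K b 0 1 := by
  intro I M g h; simpa using h

lemma HH_mul {k l : ℕ} {r s : Rb K b} (hr : HH K b k r) (hs : HH K b l s) :
    HH K b (k + l) (r * s) := by
  intro I M g h
  have := hr I _ _ (hs I M g h)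
  rw [mul_assoc]
  convert this using 1
  congr 1; omega

lemma HH_pow_zero {r : Rb K b} (hr : HH K b 0 r) (n : ℕ) : HH K b 0 (r ^ n) := by
  induction n with
  | zero => simpa using HH_one
  | succ n ih => rw [pow_succ]; have := HH_mul ih hr; rwa [Nat.add_zero] at this

lemma wt_single (v : Vb b) : wt b (Finsupp.single v 1) =
    match v with
    | Sum.inr (Sum.inl _) => 1
    | _ => 0 := by
  rcases v with i | j | k
  · simp [wt]
  · simp [wt, Finsupp.single_apply]
  · simp [wt]

lemma HH_Xv (i : ℤ) : HH K b 0 (Xv K b i) := by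
  unfold Xv
  split_ifs with h
  · have := HH_monomial (K := K) (Finsupp.single (Sum.inl ⟨i.toNat, by omega⟩ : Vb b) 1)
    rwa [wt_single] at this
  · exact HH_zero _

lemma HH_Psi (i : ℤ) : HH K b 1 (Psi K b i) := by
  unfold Psi
  split_ifs with h
  · have := HH_monomial (K := K) (Finsupp.single (Sum.inr (Sum.inl ⟨i.toNat, by omega⟩) : Vb b) 1)
    rwa [wt_single] at this
  · exact HH_zero _

lemma HH_XPhi (k : Fin 3) : HH K b 0 (X (Sum.inr (Sum.inr k))) := by
  have := HH_monomial (K := K) (Finsupp.single (Sum.inr (Sum.inr k) : Vb b) 1)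
  rwa [wt_single] at this

lemma HH_Phi (i j : ℤ) : HH K b 0 (Phi K b i j) := by
  unfold Phi
  split_ifs
  exacts [HH_XPhi _, HH_XPhi _, HH_XPhi _, HH_zero _]

lemma one_mem_FF : (1 : Rb K b) ∈ FF K b 1 :=
  Submodule.subset_span ⟨0, by simp [wt], rfl⟩

lemma HH.mem_FF {k : ℕ} {r : Rb K b} (hr : HH K b k r) : r ∈ FF K b (k + 1) := by
  have := hr ⊥ 1 1 (mem_WW_of_FF one_mem_FF)
  rw [mul_one, add_comm] at this
  simpa [WW] using this

lemma HH.mem_WW {k : ℕ} {r : Rb K b} (hr : HH K b k r) (I : Ideal (Rb K b)) :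
    r ∈ WW K b I (k + 1) := mem_WW_of_FF hr.mem_FF

variable (K b)

/-- The properties of an ideal which force it to contain the kernel. -/
structure GoodIdeal (I : Ideal (Rb K b)) : Prop where
  hb : b = 1 ∨ b = 2
  hXP : ∀ i j : ℕ, i < 3 → j < 3 - b →
    Xv K b (i + 1 : ℕ) * Psi K b j - Xv K b i * Psi K b (j + 1 : ℕ) ∈ WW K b I 1
  hPP : ∀ i j : ℕ, i < 3 - b → j < 3 - b →
    Psi K b (i + 1 : ℕ) * Psi K b j - Psi K b i * Psi K b (j + 1 : ℕ) ∈ WW K b I 2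
  hL : ∀ i : ℕ, i < 2 → Xv K b i * X (Sum.inr (Sum.inr 0)) -
    Xv K b (i + 1 : ℕ) * X (Sum.inr (Sum.inr 1)) +
    Xv K b (i + 2 : ℕ) * X (Sum.inr (Sum.inr 2)) ∈ I
  hQ1 : b = 1 → Psi K b (0 : ℕ) * X (Sum.inr (Sum.inr 0)) -
    Psi K b (1 : ℕ) * X (Sum.inr (Sum.inr 1)) +
    Psi K b (2 : ℕ) * X (Sum.inr (Sum.inr 2)) ∈ WW K b I 1
  hQ2 : b = 2 → Psi K b (0 : ℕ) * Psi K b (0 : ℕ) * X (Sum.inr (Sum.inr 0)) -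
    Psi K b (0 : ℕ) * Psi K b (1 : ℕ) * X (Sum.inr (Sum.inr 1)) +
    Psi K b (1 : ℕ) * Psi K b (1 : ℕ) * X (Sum.inr (Sum.inr 2)) ∈ WW K b I 2

lemma connect {ι : Type} [Fintype ι] [DecidableEq ι] (cap : ι → ℕ)
    (r : (ι → ℕ) → (ι → ℕ) → Prop) (hrefl : ∀ f, r f f)
    (htrans : ∀ f g h, r f g → r g h → r f h)
    (step : ∀ f i j, i ≠ j → (∀ k, f k ≤ cap k) → f i < cap i → 0 < f j →
      r f (Function.update (Function.update f i (f i + 1)) j (f j - 1))) :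
    ∀ (n : ℕ) (f g : ι → ℕ), (∀ k, f k ≤ cap k) → (∀ k, g k ≤ cap k) →
      ∑ k, f k = ∑ k, g k → ∑ k, (f k - g k) ≤ n → r f g := by
  intro n
  induction n with
  | zero =>
    intro f g hf hg hs hn
    have h1 : ∀ k ∈ Finset.univ, f k ≤ g k := by
      intro k _
      have := Finset.sum_eq_zero_iff.1 (Nat.le_zero.1 hn) k (Finset.mem_univ k)
      omega
    have h2 := (Finset.sum_eq_sum_iff_of_le h1).1 hs
    have : f = g := funext fun k => h2 k (Finset.mem_univ k)
    rw [this]; exact hrefl g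
  | succ n ih =>
    intro f g hf hg hs hn
    by_cases hfg : f = g
    · rw [hfg]; exact hrefl g
    have hi : ∃ i, f i < g i := by
      by_contra hcon
      push Not at hcon
      have h2 := (Finset.sum_eq_sum_iff_of_le (fun k _ => hcon k)).1 hs.symm
      exact hfg (funext fun k => (h2 k (Finset.mem_univ k)).symm)
    have hj : ∃ j, g j < f j := by
      by_contra hcon
      push Not at hcon
      have h2 := (Finset.sum_eq_sum_iff_of_le (fun k _ => hcon k)).1 hs
      exact hfg (funext fun k => (h2 k (Finset.mem_univ k)))
    obtain ⟨i, hi⟩ := hi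
    obtain ⟨j, hj⟩ := hj
    have hij : i ≠ j := by rintro rfl; omega
    have hval : ∀ k, Function.update (Function.update f i (f i + 1)) j (f j - 1) k =
        if k = j then f j - 1 else if k = i then f i + 1 else f k := by
      intro k; simp [Function.update_apply]
    refine htrans _ _ _ (step f i j hij hf (by have := hg i; omega) (by omega)) (ih _ _ ?_ hg ?_ ?_)
    · intro k
      rw [hval]
      split_ifs with h1 h2
      · subst h1; have := hf k; omega
      · subst h2; have := hg k; omega
      · exact hf k
    · rw [← hs]
      have : ∑ k, (Function.update (Function.update f i (f i + 1)) j (f j - 1) k +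
          (if k = j then 1 else 0)) = ∑ k, (f k + (if k = i then 1 else 0)) := by
        refine Finset.sum_congr rfl fun k _ => ?_
        rw [hval]
        by_cases h1 : k = j
        · subst h1; rw [if_pos rfl, if_pos rfl, if_neg (Ne.symm hij)]; omega
        · by_cases h2 : k = i
          · subst h2; simp [h1]
          · simp [h1, h2]
      rw [Finset.sum_add_distrib, Finset.sum_add_distrib] at this
      simpa using this
    · have : ∑ k, (Function.update (Function.update f i (f i + 1)) j (f j - 1) k - g k) <
          ∑ k, (f k - g k) := by
        refine Finset.sum_lt_sum (fun k _ => ?_) ⟨j, Finset.mem_univ j, ?_⟩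
        · rw [hval]
          split_ifs with h1 h2
          · subst h1; omega
          · subst h2; omega
          · exact le_rfl
        · rw [hval, if_pos rfl]; omega
      omega

lemma exists_fill {ι : Type} [Fintype ι] [DecidableEq ι] (cap : ι → ℕ) (s : ℕ)
    (hs : s ≤ ∑ k, cap k) : ∃ f : ι → ℕ, (∀ k, f k ≤ cap k) ∧ ∑ k, f k = s := by
  induction s with
  | zero => exact ⟨fun _ => 0, by simp, by simp⟩
  | succ s ih =>
    obtain ⟨f, hf, hsum⟩ := ih (by omega)
    obtain ⟨i, -, hi⟩ := Finset.exists_lt_of_sum_lt (s := Finset.univ) (f := f) (g := cap) (by omega)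
    refine ⟨fun k => f k + if k = i then 1 else 0, ?_, ?_⟩
    · intro k
      beta_reduce
      split_ifs with h
      · subst h; exact hi
      · exact hf k
    · rw [Finset.sum_add_distrib]; simp [hsum]

/-- The variable in a given slot. -/
def VV {n N : ℕ} (s : Fin n ⊕ Fin N) (k : ℕ) : Rb K b :=
  Sum.elim (fun _ => Xv K b k) (fun _ => Psi K b k) s

/-- The maximal index in a given slot. -/
def cap {n N : ℕ} (s : Fin n ⊕ Fin N) : ℕ := Sum.elim (fun _ => 3) (fun _ => 3 - b) s

/-- The `Ψ`-weight of a slot. -/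
def tw {n N : ℕ} (s : Fin n ⊕ Fin N) : ℕ := Sum.elim (fun _ => 0) (fun _ => 1) s

/-- The product attached to a slot function. -/
def PF {n N : ℕ} (f : Fin n ⊕ Fin N → ℕ) : Rb K b := ∏ s, VV K b s (f s)

lemma HH_VV {n N : ℕ} (s : Fin n ⊕ Fin N) (k : ℕ) : HH K b (tw s) (VV K b s k) := by
  rcases s with s | s
  · exact HH_Xv _
  · exact HH_Psi _

lemma HH_prod {n N : ℕ} (f : Fin n ⊕ Fin N → ℕ) (S : Finset (Fin n ⊕ Fin N)) :
    HH K b (∑ s ∈ S, tw s) (∏ s ∈ S, VV K b s (f s)) := by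
  classical
  induction S using Finset.induction_on with
  | empty => simpa using HH_one
  | insert s S hs ih =>
    rw [Finset.sum_insert hs, Finset.prod_insert hs]
    exact HH_mul (HH_VV K b _ _) ih

lemma sum_tw (n N : ℕ) : ∑ s : Fin n ⊕ Fin N, tw s = N := by
  simp [tw]

lemma sum_cap (n N : ℕ) : ∑ s : Fin n ⊕ Fin N, cap b s = 3 * n + (3 - b) * N := by
  simp [cap, mul_comm]

lemma HH_PF {n N : ℕ} (f : Fin n ⊕ Fin N → ℕ) : HH K b N (PF K b f) := by
  have := HH_prod K b f Finset.univ
  rwa [sum_tw] at this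

variable {K b} in
lemma step_XX {I : Ideal (Rb K b)} (hI : GoodIdeal K b I) (x c e : ℕ) (hx : x < 3) (hc : c < 3)
    (he : e ≤ 3 - b) :
    Psi K b e * (Xv K b x * Xv K b (c + 1 : ℕ) - Xv K b (x + 1 : ℕ) * Xv K b c) ∈ WW K b I 1 := by
  have hb := hI.hb
  by_cases h : e < 3 - b
  · have h1 := HH_Xv (K := K) (b := b) x I 1 _ (hI.hXP c e hc h)
    have h2 := HH_Xv (K := K) (b := b) c I 1 _ (hI.hXP x e hx h)
    convert sub_mem h1 h2 using 1
    ring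
  · obtain ⟨e, rfl⟩ : ∃ e', e = e' + 1 := ⟨e - 1, by omega⟩
    have h1 := HH_Xv (K := K) (b := b) (c + 1 : ℕ) I 1 _ (hI.hXP x e hx (by omega))
    have h2 := HH_Xv (K := K) (b := b) (x + 1 : ℕ) I 1 _ (hI.hXP c e hc (by omega))
    convert sub_mem h2 h1 using 1
    ring

variable {K b} in
lemma PF_congr {I : Ideal (Rb K b)} (hI : GoodIdeal K b I) {n N : ℕ} (hN : 1 ≤ N)
    (f g : Fin n ⊕ Fin N → ℕ) (hf : ∀ k, f k ≤ cap b k) (hg : ∀ k, g k ≤ cap b k)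
    (hs : ∑ k, f k = ∑ k, g k) : PF K b f - PF K b g ∈ WW K b I N := by
  refine connect (cap b) (fun f g => PF K b f - PF K b g ∈ WW K b I N) ?_ ?_ ?_ _ f g hf hg hs le_rfl
  · intro f; simp
  · intro f g h h1 h2
    convert add_mem h1 h2 using 1; ring
  · clear hs hf hg f g
    intro f i j hij hf hi hj
    set f' := Function.update (Function.update f i (f i + 1)) j (f j - 1) with hf'
    have hi' : f' i = f i + 1 := by simp [hf', Function.update_apply, hij]
    have hj' : f' j = f j - 1 := by simp [hf']
    have hk' : ∀ k, k ≠ i → k ≠ j → f' k = f k := by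
      intro k h1 h2; simp [hf', Function.update_apply, h1, h2]
    have hji : j ∈ Finset.univ.erase i := Finset.mem_erase.2 ⟨hij.symm, Finset.mem_univ _⟩
    have hprod : ∀ f : Fin n ⊕ Fin N → ℕ, PF K b f = VV K b i (f i) * (VV K b j (f j) *
        ∏ s ∈ (Finset.univ.erase i).erase j, VV K b s (f s)) := by
      intro f
      rw [Finset.mul_prod_erase _ (fun s => VV K b s (f s)) hji,
        Finset.mul_prod_erase _ (fun s => VV K b s (f s)) (Finset.mem_univ i)]
      rfl
    have hsum : tw i + (tw j + ∑ s ∈ (Finset.univ.erase i).erase j, tw s) = N := by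
      rw [Finset.add_sum_erase _ _ hji, Finset.add_sum_erase _ _ (Finset.mem_univ i), sum_tw]
    have hrest : ∏ s ∈ (Finset.univ.erase i).erase j, VV K b s (f' s) =
        ∏ s ∈ (Finset.univ.erase i).erase j, VV K b s (f s) := by
      refine Finset.prod_congr rfl fun s hs => ?_
      simp only [Finset.mem_erase] at hs
      rw [hk' s hs.2.1 hs.1]
    rw [hprod f, hprod f', hrest, hi', hj']
    obtain ⟨c, hc⟩ : ∃ c, f j = c + 1 := ⟨f j - 1, by omega⟩
    have hcap := hf j
    rw [hc] at hcap ⊢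
    rw [Nat.add_sub_cancel]
    have hH := HH_prod K b f ((Finset.univ.erase i).erase j)
    rcases i with i | i <;> rcases j with j | j
    · simp only [cap, Sum.elim_inl] at hi hcap
      simp only [tw, Sum.elim_inl, zero_add] at hsum
      have hk : Sum.inr ⟨0, hN⟩ ∈ (Finset.univ.erase (Sum.inl i : Fin n ⊕ Fin N)).erase (Sum.inl j) := by
        simp
      have hH' := HH_prod K b f (((Finset.univ.erase (Sum.inl i)).erase (Sum.inl j)).erase
        (Sum.inr ⟨0, hN⟩))
      rw [← Finset.add_sum_erase _ _ hk] at hsum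
      rw [← Finset.mul_prod_erase _ _ hk]
      have h := hH' I 1 _ (step_XX hI (f (Sum.inl i)) c (f (Sum.inr ⟨0, hN⟩)) hi (by omega)
        (hf (Sum.inr ⟨0, hN⟩)))
      simp only [Sum.elim_inr] at hsum
      convert WW_cast hsum h using 1
      simp only [VV, Sum.elim_inl, Sum.elim_inr]
      ring
    · simp only [cap, Sum.elim_inl, Sum.elim_inr] at hi hcap
      have h := hH I 1 _ (hI.hXP (f (Sum.inl i)) c hi (by omega))
      simp only [tw, Sum.elim_inl, Sum.elim_inr, zero_add] at hsum
      rw [← neg_mem_iff]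
      convert WW_cast hsum h using 1
      simp only [VV, Sum.elim_inl, Sum.elim_inr]
      ring
    · simp only [cap, Sum.elim_inl, Sum.elim_inr] at hi hcap
      have h := hH I 1 _ (hI.hXP c (f (Sum.inr i)) (by omega) hi)
      simp only [tw, Sum.elim_inl, Sum.elim_inr, zero_add] at hsum
      convert WW_cast hsum h using 1
      simp only [VV, Sum.elim_inl, Sum.elim_inr]
      ring
    · simp only [cap, Sum.elim_inr] at hi hcap
      have h := hH I 2 _ (hI.hPP (f (Sum.inr i)) c hi (by omega))
      simp only [tw, Sum.elim_inr] at hsum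
      rw [← neg_mem_iff]
      convert WW_cast ((Nat.add_assoc 1 1 _).trans hsum) h using 1
      simp only [VV, Sum.elim_inr]
      ring

end Filtration

section Rho

variable {K b} in
/-- Add a new `X` slot. -/
def consX {n N : ℕ} (k : ℕ) (f : Fin n ⊕ Fin N → ℕ) : Fin (n + 1) ⊕ Fin N → ℕ :=
  Sum.elim (Fin.cons k (fun i => f (Sum.inl i))) (fun j => f (Sum.inr j))

/-- Add a new `Ψ` slot. -/
def consP {n N : ℕ} (k : ℕ) (f : Fin n ⊕ Fin N → ℕ) : Fin n ⊕ Fin (N + 1) → ℕ :=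
  Sum.elim (fun i => f (Sum.inl i)) (Fin.cons k (fun j => f (Sum.inr j)))

/-- Admissible slot functions. -/
def Adm {n N : ℕ} (f : Fin n ⊕ Fin N → ℕ) : Prop := ∀ k, f k ≤ cap b k

lemma sum_consX {n N : ℕ} (k : ℕ) (f : Fin n ⊕ Fin N → ℕ) :
    ∑ s, consX k f s = k + ∑ s, f s := by
  simp only [consX, Fintype.sum_sum_type, Sum.elim_inl, Sum.elim_inr, Fin.sum_univ_succ,
    Fin.cons_zero, Fin.cons_succ]
  omega

lemma sum_consP {n N : ℕ} (k : ℕ) (f : Fin n ⊕ Fin N → ℕ) :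
    ∑ s, consP k f s = k + ∑ s, f s := by
  simp only [consP, Fintype.sum_sum_type, Sum.elim_inl, Sum.elim_inr, Fin.sum_univ_succ,
    Fin.cons_zero, Fin.cons_succ]
  omega

lemma PF_consX {n N : ℕ} (k : ℕ) (f : Fin n ⊕ Fin N → ℕ) :
    PF K b (consX k f) = Xv K b k * PF K b f := by
  simp only [PF, VV, consX, Fintype.prod_sum_type, Sum.elim_inl, Sum.elim_inr, Fin.prod_univ_succ,
    Fin.cons_zero, Fin.cons_succ]
  ring

lemma PF_consP {n N : ℕ} (k : ℕ) (f : Fin n ⊕ Fin N → ℕ) :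
    PF K b (consP k f) = Psi K b k * PF K b f := by
  simp only [PF, VV, consP, Fintype.prod_sum_type, Sum.elim_inl, Sum.elim_inr, Fin.prod_univ_succ,
    Fin.cons_zero, Fin.cons_succ]
  ring

lemma Adm_consX {n N : ℕ} (k : ℕ) (f : Fin n ⊕ Fin N → ℕ) (hk : k ≤ 3) (hf : Adm b f) :
    Adm b (consX k f) := by
  rintro (i | j)
  · refine Fin.cases ?_ (fun i => ?_) i
    · simpa [consX, cap] using hk
    · simpa [consX, cap] using hf (Sum.inl i)
  · simpa [consX, cap] using hf (Sum.inr j)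

lemma Adm_consP {n N : ℕ} (k : ℕ) (f : Fin n ⊕ Fin N → ℕ) (hk : k ≤ 3 - b) (hf : Adm b f) :
    Adm b (consP k f) := by
  rintro (j | i)
  · simpa [consP, cap] using hf (Sum.inl j)
  · refine Fin.cases ?_ (fun i => ?_) i
    · simpa [consP, cap] using hk
    · simpa [consP, cap] using hf (Sum.inr i)

open Classical in
/-- A chosen lift of the monomial `σ^A τ^B`. -/
def EN (N A B : ℕ) : Rb K b :=
  if h : ∃ n, ∃ f : Fin n ⊕ Fin N → ℕ, Adm b f ∧ ∑ s, f s = B ∧ A + B = 3 * n + (3 - b) * N then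
    PF K b h.choose_spec.choose else 0

variable {K b}

lemma EN_spec {I : Ideal (Rb K b)} (hI : GoodIdeal K b I) {n N : ℕ} (hN : 1 ≤ N) (A B : ℕ)
    (f : Fin n ⊕ Fin N → ℕ) (hf : Adm b f) (hs : ∑ s, f s = B)
    (hn : A + B = 3 * n + (3 - b) * N) : EN K b N A B - PF K b f ∈ WW K b I N := by
  have h : ∃ n, ∃ f : Fin n ⊕ Fin N → ℕ, Adm b f ∧ ∑ s, f s = B ∧ A + B = 3 * n + (3 - b) * N :=
    ⟨n, f, hf, hs, hn⟩
  have hE : ∃ (n' : ℕ) (f' : Fin n' ⊕ Fin N → ℕ), Adm b f' ∧ ∑ s, f' s = B ∧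
      A + B = 3 * n' + (3 - b) * N ∧ EN K b N A B = PF K b f' := by
    refine ⟨h.choose, h.choose_spec.choose, h.choose_spec.choose_spec.1,
      h.choose_spec.choose_spec.2.1, h.choose_spec.choose_spec.2.2, ?_⟩
    rw [EN, dif_pos h]
  obtain ⟨n', f', hf', hs', hn', hE⟩ := hE
  have hnn : n' = n := by omega
  subst hnn
  rw [hE]
  exact PF_congr hI hN f' f hf' hf (hs'.trans hs.symm)

lemma EN_zero {N A B : ℕ} (h : ∀ n, A + B ≠ 3 * n + (3 - b) * N) : EN K b N A B = 0 := by
  rw [EN, dif_neg]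
  rintro ⟨n, f, -, -, h'⟩
  exact h n h'

lemma EN_rel_aux {I : Ideal (Rb K b)} (hI : GoodIdeal K b I) {n N : ℕ} (hN : 1 ≤ N) (A B : ℕ)
    (f0 f1 f2 : Fin n ⊕ Fin N → ℕ) (hf0 : Adm b f0) (hf1 : Adm b f1) (hf2 : Adm b f2)
    (hs0 : ∑ s, f0 s = B) (hs1 : ∑ s, f1 s = B + 1) (hs2 : ∑ s, f2 s = B + 2)
    (hn : A + B + 2 = 3 * n + (3 - b) * N)
    (h : PF K b f0 * X (Sum.inr (Sum.inr 0)) - PF K b f1 * X (Sum.inr (Sum.inr 1)) +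
      PF K b f2 * X (Sum.inr (Sum.inr 2)) ∈ WW K b I N) :
    EN K b N (A + 2) B * X (Sum.inr (Sum.inr 0)) - EN K b N (A + 1) (B + 1) *
      X (Sum.inr (Sum.inr 1)) + EN K b N A (B + 2) * X (Sum.inr (Sum.inr 2)) ∈ WW K b I N := by
  have h0 := HH_XPhi (K := K) (b := b) 0 I N _
    (EN_spec hI hN (A + 2) B f0 hf0 hs0 (by omega))
  have h1 := HH_XPhi (K := K) (b := b) 1 I N _
    (EN_spec hI hN (A + 1) (B + 1) f1 hf1 hs1 (by omega))
  have h2 := HH_XPhi (K := K) (b := b) 2 I N _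
    (EN_spec hI hN A (B + 2) f2 hf2 hs2 (by omega))
  rw [Nat.add_zero] at h0 h1 h2
  convert add_mem (add_mem (sub_mem h0 h1) h2) h using 1
  ring

lemma EN_rel {I : Ideal (Rb K b)} (hI : GoodIdeal K b I) {N : ℕ} (hN : 1 ≤ N) (A B : ℕ) :
    EN K b N (A + 2) B * X (Sum.inr (Sum.inr 0)) - EN K b N (A + 1) (B + 1) *
      X (Sum.inr (Sum.inr 1)) + EN K b N A (B + 2) * X (Sum.inr (Sum.inr 2)) ∈ WW K b I N := by
  by_cases h : ∃ n, A + B + 2 = 3 * n + (3 - b) * N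
  swap
  · push Not at h
    rw [EN_zero (fun n hn => h n (by omega)), EN_zero (fun n hn => h n (by omega)),
      EN_zero (fun n hn => h n (by omega))]
    simp
  obtain ⟨n, hn⟩ := h
  rcases n with _ | n
  · rcases hI.hb with hb | hb
    · obtain ⟨N, rfl⟩ : ∃ N', N = N' + 1 := ⟨N - 1, by omega⟩
      have hcap : ∑ s : Fin 0 ⊕ Fin N, cap b s = A + B := by
        rw [sum_cap]; rw [hb] at hn ⊢; omega
      obtain ⟨f, hf, hs⟩ := exists_fill (cap b : Fin 0 ⊕ Fin N → ℕ) B (by omega)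
      refine EN_rel_aux hI hN A B (consP 0 f) (consP 1 f) (consP 2 f)
        (Adm_consP _ _ _ (by omega) hf) (Adm_consP _ _ _ (by omega) hf)
        (Adm_consP _ _ _ (by omega) hf) (by rw [sum_consP]; omega) (by rw [sum_consP]; omega)
        (by rw [sum_consP]; omega) hn ?_
      rw [PF_consP, PF_consP, PF_consP]
      have := HH_PF K b f I 1 _ (hI.hQ1 hb)
      convert WW_cast (Nat.add_comm 1 N) this using 1
      ring
    · obtain ⟨N, rfl⟩ : ∃ N', N = N' + 2 := ⟨N - 2, by rw [hb] at hn; omega⟩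
      have hcap : ∑ s : Fin 0 ⊕ Fin N, cap b s = A + B := by
        rw [sum_cap]; rw [hb] at hn ⊢; omega
      obtain ⟨f, hf, hs⟩ := exists_fill (cap b : Fin 0 ⊕ Fin N → ℕ) B (by omega)
      have hf0 := Adm_consP b 0 f (by omega) hf
      have hf1 := Adm_consP b 1 f (by omega) hf
      refine EN_rel_aux hI hN A B (consP 0 (consP 0 f)) (consP 0 (consP 1 f)) (consP 1 (consP 1 f))
        (Adm_consP _ _ _ (by omega) hf0) (Adm_consP _ _ _ (by omega) hf1)
        (Adm_consP _ _ _ (by omega) hf1) (by rw [sum_consP, sum_consP]; omega)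
        (by rw [sum_consP, sum_consP]; omega)
        (by rw [sum_consP, sum_consP]; omega) hn ?_
      simp only [PF_consP]
      have := HH_PF K b f I 2 _ (hI.hQ2 hb)
      convert WW_cast (Nat.add_comm 2 N) this using 1
      ring
  · have hcap : ∑ s : Fin n ⊕ Fin N, cap b s + 1 = A + B := by
      rw [sum_cap]; omega
    rcases Nat.eq_zero_or_pos A with hA | hA
    · obtain ⟨f, hf, hs⟩ := exists_fill (cap b : Fin n ⊕ Fin N → ℕ) (B - 1) (by omega)
      refine EN_rel_aux hI hN A B (consX 1 f) (consX 2 f) (consX 3 f)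
        (Adm_consX _ _ _ (by omega) hf) (Adm_consX _ _ _ (by omega) hf)
        (Adm_consX _ _ _ (by omega) hf) (by rw [sum_consX]; omega) (by rw [sum_consX]; omega)
        (by rw [sum_consX]; omega) hn ?_
      rw [PF_consX, PF_consX, PF_consX]
      have := mem_WW_of_mem (N := N) (I.mul_mem_left (PF K b f) (hI.hL 1 (by omega)))
      convert this using 1
      ring
    · obtain ⟨f, hf, hs⟩ := exists_fill (cap b : Fin n ⊕ Fin N → ℕ) B (by omega)
      refine EN_rel_aux hI hN A B (consX 0 f) (consX 1 f) (consX 2 f)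
        (Adm_consX _ _ _ (by omega) hf) (Adm_consX _ _ _ (by omega) hf)
        (Adm_consX _ _ _ (by omega) hf) (by rw [sum_consX]; omega) (by rw [sum_consX]; omega)
        (by rw [sum_consX]; omega) hn ?_
      rw [PF_consX, PF_consX, PF_consX]
      have := mem_WW_of_mem (N := N) (I.mul_mem_left (PF K b f) (hI.hL 0 (by omega)))
      convert this using 1
      ring

variable (K b)

/-- A monomial in the `Φ`. -/
def QM (i j k : ℕ) : Rb K b :=
  X (Sum.inr (Sum.inr 2)) ^ i * X (Sum.inr (Sum.inr 1)) ^ j * X (Sum.inr (Sum.inr 0)) ^ k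

variable {K b} in
lemma HH_mul_zero {r s : Rb K b} (hr : HH K b 0 r) (hs : HH K b 0 s) : HH K b 0 (r * s) := by
  have := HH_mul hr hs
  rwa [Nat.add_zero] at this

lemma HH_QM (i j k : ℕ) : HH K b 0 (QM K b i j k) :=
  HH_mul_zero (HH_mul_zero (HH_pow_zero (HH_XPhi _) _) (HH_pow_zero (HH_XPhi _) _))
    (HH_pow_zero (HH_XPhi _) _)

/-- The linear section. -/
def rho (N : ℕ) : MvPolynomial (Fin 5) K →ₗ[K] Rb K b :=
  (basisMonomials (Fin 5) K).constr K fun m => EN K b N (m 0) (m 1) * QM K b (m 2) (m 3) (m 4)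

/-- A monomial in five variables. -/
def mon (A B i j k : ℕ) : MvPolynomial (Fin 5) K := X 0 ^ A * X 1 ^ B * X 2 ^ i * X 3 ^ j * X 4 ^ k

lemma mon_eq (m : Fin 5 →₀ ℕ) : (monomial m 1 : MvPolynomial (Fin 5) K) =
    mon K (m 0) (m 1) (m 2) (m 3) (m 4) := by
  rw [monomial_eq, Finsupp.prod_fintype _ _ (by simp)]
  simp [mon, Fin.prod_univ_five]

lemma rho_mon (N A B i j k : ℕ) : rho K b N (mon K A B i j k) = EN K b N A B * QM K b i j k := by
  have h := mon_eq K (Finsupp.equivFunOnFinite.symm ![A, B, i, j, k])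
  simp only [Finsupp.equivFunOnFinite_symm_apply_apply] at h
  have h2 : mon K A B i j k = basisMonomials (Fin 5) K
      (Finsupp.equivFunOnFinite.symm ![A, B, i, j, k]) := by
    rw [coe_basisMonomials]; exact h.symm
  rw [h2, rho, Module.Basis.constr_basis]
  rfl

variable {K b}

lemma rho_ell {I : Ideal (Rb K b)} (hI : GoodIdeal K b I) {N : ℕ} (hN : 1 ≤ N)
    (G : MvPolynomial (Fin 5) K) : rho K b N (ell K * G) ∈ WW K b I N := by
  induction G using MvPolynomial.induction_on' with
  | monomial m c =>
    have h1 : (monomial m c : MvPolynomial (Fin 5) K) = c • mon K (m 0) (m 1) (m 2) (m 3) (m 4) := by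
      rw [← mon_eq, smul_monomial, smul_eq_mul, mul_one]
    rw [h1, mul_smul_comm, map_smul]
    refine Submodule.smul_mem _ _ ?_
    have h2 : ell K * mon K (m 0) (m 1) (m 2) (m 3) (m 4) =
        mon K (m 0 + 2) (m 1) (m 2) (m 3) (m 4 + 1) - mon K (m 0 + 1) (m 1 + 1) (m 2) (m 3 + 1) (m 4)
        + mon K (m 0) (m 1 + 2) (m 2 + 1) (m 3) (m 4) := by
      simp only [ell, mon]; ring
    rw [h2, map_add, map_sub, rho_mon, rho_mon, rho_mon]
    have h3 := HH_QM K b (m 2) (m 3) (m 4) I N _ (EN_rel hI hN (m 0) (m 1))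
    rw [Nat.add_zero] at h3
    convert h3 using 1
    simp only [QM]; ring
  | add p q hp hq => rw [mul_add, map_add]; exact add_mem hp hq

variable (K b)

/-- The specialization `Λ`. -/
def Lam : Rb K b →ₐ[K] Polynomial (MvPolynomial (Fin 5) K) :=
  aeval fun v =>
    match v with
    | Sum.inl i => Polynomial.C (X 0 ^ (3 - (i : ℕ)) * X 1 ^ (i : ℕ))
    | Sum.inr (Sum.inl j) => Polynomial.C (X 0 ^ (3 - b - (j : ℕ)) * X 1 ^ (j : ℕ)) * Polynomial.X
    | Sum.inr (Sum.inr k) => Polynomial.C (if k = 0 then X 4 else if k = 1 then X 3 else X 2)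

lemma Xv_coe (i : Fin 4) : Xv K b ((i : ℕ) : ℤ) = X (Sum.inl i) := by
  rw [Xv, dif_pos ⟨by omega, by omega⟩]; rfl

lemma Psi_coe (j : Fin (4 - b)) : Psi K b ((j : ℕ) : ℤ) = X (Sum.inr (Sum.inl j)) := by
  rw [Psi, dif_pos ⟨by omega, by omega⟩]; rfl

lemma Lam_VV (hb : b ≤ 3) {n N : ℕ} (s : Fin n ⊕ Fin N) (k : ℕ) (hk : k ≤ cap b s) :
    Lam K b (VV K b s k) =
      Polynomial.C (X 0 ^ (cap b s - k) * X 1 ^ k) * Polynomial.X ^ tw s := by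
  rcases s with s | s
  · simp only [cap, Sum.elim_inl] at hk
    have := Xv_coe K b ⟨k, by omega⟩
    simp only [VV, cap, tw, Sum.elim_inl]
    simp only at this
    rw [this]
    simp [Lam]
  · simp only [cap, Sum.elim_inr] at hk
    have := Psi_coe K b ⟨k, by omega⟩
    simp only [VV, cap, tw, Sum.elim_inr]
    simp only at this
    rw [this]
    simp [Lam]

lemma Lam_PF (hb : b ≤ 3) {n N : ℕ} (f : Fin n ⊕ Fin N → ℕ) (hf : Adm b f) : ∃ A,
    A + ∑ s, f s = 3 * n + (3 - b) * N ∧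
    Lam K b (PF K b f) = Polynomial.C (X 0 ^ A * X 1 ^ (∑ s, f s)) * Polynomial.X ^ N := by
  refine ⟨∑ s, (cap b s - f s), ?_, ?_⟩
  · rw [← Finset.sum_add_distrib, ← sum_cap]
    exact Finset.sum_congr rfl fun s _ => Nat.sub_add_cancel (hf s)
  · rw [PF, map_prod, Finset.prod_congr rfl fun s _ => Lam_VV K b hb s (f s) (hf s),
      Finset.prod_mul_distrib, Finset.prod_pow_eq_pow_sum, sum_tw, ← map_prod,
      Finset.prod_mul_distrib, Finset.prod_pow_eq_pow_sum, Finset.prod_pow_eq_pow_sum]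

lemma Lam_QM (i j k : ℕ) : Lam K b (QM K b i j k) =
    Polynomial.C (X 2 ^ i * X 3 ^ j * X 4 ^ k) := by
  simp [Lam, QM]

lemma monomial_form (s : Multiset (Vb b)) : ∃ (n : ℕ)
    (f : Fin n ⊕ Fin (wt b (Multiset.toFinsupp s)) → ℕ) (i j k : ℕ), Adm b f ∧
    (monomial (Multiset.toFinsupp s) 1 : Rb K b) = PF K b f * QM K b i j k := by
  induction s using Multiset.induction_on with
  | empty =>
    rw [map_zero]
    refine ⟨0, fun _ => 0, 0, 0, 0, fun _ => Nat.zero_le _, ?_⟩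
    have : wt b 0 = 0 := by simp [wt]
    have : IsEmpty (Fin (wt b 0)) := by rw [this]; infer_instance
    simp [QM, PF, Fintype.prod_sum_type]
  | cons v s ih =>
    have hm : Multiset.toFinsupp (v ::ₘ s) = Finsupp.single v 1 + Multiset.toFinsupp s := by
      rw [← Multiset.singleton_add, map_add, Multiset.toFinsupp_singleton]
    rw [hm]
    generalize Multiset.toFinsupp s = m at ih ⊢
    obtain ⟨n, f, i, j, k, hf, h⟩ := ih
    have hX : (monomial (Finsupp.single v 1 + m) 1 : Rb K b) = X v * monomial m 1 := by
      rw [X, monomial_mul, one_mul]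
    rw [hX, h, wt_add, wt_single]
    rcases v with v | v | v
    · simp only
      rw [Nat.zero_add]
      refine ⟨n + 1, consX v f, i, j, k, Adm_consX _ _ _ (by omega) hf, ?_⟩
      rw [PF_consX, Xv_coe]; ring
    · simp only
      rw [Nat.add_comm]
      refine ⟨n, consP v f, i, j, k, Adm_consP _ _ _ (by omega) hf, ?_⟩
      rw [PF_consP, Psi_coe]; ring
    · simp only
      rw [Nat.zero_add]
      fin_cases v
      · exact ⟨n, f, i, j, k + 1, hf, by simp only [QM, Fin.zero_eta]; ring⟩
      · exact ⟨n, f, i, j + 1, k, hf, by simp only [QM, Fin.mk_one]; ring⟩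
      · exact ⟨n, f, i + 1, j, k, hf, by simp only [QM, Fin.reduceFinMk]; ring⟩

variable {K b}

lemma FF_mono {M N : ℕ} (h : M ≤ N) : FF K b M ≤ FF K b N :=
  Submodule.span_mono fun _ ⟨m, hm, hg⟩ => ⟨m, by omega, hg⟩

lemma reduce_top {I : Ideal (Rb K b)} (hI : GoodIdeal K b I) {N : ℕ} (hN : 1 ≤ N)
    (g : Rb K b) (hg : g ∈ FF K b (N + 1)) :
    g - rho K b N ((Lam K b g).coeff N) ∈ WW K b I N := by
  unfold FF at hg
  induction hg using Submodule.span_induction with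
  | mem g hg =>
    obtain ⟨m, hm, rfl⟩ := hg
    obtain ⟨s, rfl⟩ := Multiset.toFinsupp.surjective m
    obtain ⟨n, f, i, j, k, hf, h⟩ := monomial_form K b s
    have hb := hI.hb
    obtain ⟨A, hA, hL⟩ := Lam_PF K b (by omega) f hf
    have hc : Lam K b (PF K b f * QM K b i j k) = Polynomial.C (mon K A (∑ s, f s) i j k) *
        Polynomial.X ^ (wt b (Multiset.toFinsupp s)) := by
      rw [map_mul, hL, Lam_QM, mul_right_comm, ← map_mul]
      congr 2
      simp only [mon]; ring
    have hFF : (monomial (Multiset.toFinsupp s) 1 : Rb K b) ∈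
        FF K b (wt b (Multiset.toFinsupp s) + 1) :=
      Submodule.subset_span ⟨_, by omega, rfl⟩
    rw [h] at hFF ⊢
    rw [hc, Polynomial.coeff_C_mul_X_pow]
    clear h hc hL
    generalize wt b (Multiset.toFinsupp s) = w at *
    split_ifs with hw
    · subst hw
      rw [rho_mon, ← sub_mul]
      have := HH_QM K b i j k I N _ (EN_spec hI hN A _ f hf rfl hA)
      rw [Nat.add_zero] at this
      rw [← neg_mem_iff]
      convert this using 1
      ring
    · rw [map_zero, sub_zero]
      exact mem_WW_of_FF (FF_mono (by omega) hFF)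
  | zero => simp
  | add x y _ _ hx hy =>
    rw [map_add, Polynomial.coeff_add, map_add]
    convert add_mem hx hy using 1; ring
  | smul c x _ hx =>
    rw [map_smul, Polynomial.coeff_smul, map_smul, ← smul_sub]
    exact Submodule.smul_mem _ _ hx

/-- The induction step. -/
lemma mem_of_dvd {I E : Ideal (Rb K b)} (hI : GoodIdeal K b I) (hIE : I ≤ E)
    (hdvd : ∀ N, 1 ≤ N → ∀ g ∈ E, g ∈ FF K b (N + 1) → ell K ∣ (Lam K b g).coeff N)
    (hbase : ∀ g ∈ E, g ∈ FF K b 1 → g ∈ I) (N : ℕ) :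
    ∀ g ∈ E, g ∈ FF K b (N + 1) → g ∈ I := by
  induction N with
  | zero => exact hbase
  | succ N ih =>
    intro g hgE hg
    have h1 := reduce_top hI (by omega) g hg
    obtain ⟨u, hu⟩ := hdvd (N + 1) (by omega) g hgE hg
    have h2 := rho_ell hI (N := N + 1) (by omega) u
    rw [hu] at h1
    have h3 : g ∈ WW K b I (N + 1) := by
      have := add_mem h1 h2
      rwa [sub_add_cancel] at this
    obtain ⟨x, hx, y, hy, rfl⟩ := Submodule.mem_sup.1 h3
    have hx' : x ∈ I := hx
    refine I.add_mem hx' (ih y ?_ hy)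
    have := E.sub_mem hgE (hIE hx')
    rwa [add_sub_cancel_left] at this

lemma exists_FF (g : Rb K b) : ∃ N, g ∈ FF K b (N + 1) := by
  induction g using MvPolynomial.induction_on' with
  | monomial m c =>
    refine ⟨wt b m, ?_⟩
    have : (monomial m c : Rb K b) = c • monomial m 1 := by
      rw [smul_monomial, smul_eq_mul, mul_one]
    rw [this]
    exact Submodule.smul_mem _ _ (Submodule.subset_span ⟨m, by omega, rfl⟩)
  | add p q hp hq =>
    obtain ⟨M, hM⟩ := hp
    obtain ⟨N, hN⟩ := hq
    exact ⟨M + N, add_mem (FF_mono (by omega) hM) (FF_mono (by omega) hN)⟩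

end Rho

section Special

lemma phiR11 : phiR K 1 1 = X 1 * X 1 - X 2 * X 0 := by
  simp [phiR, eps, XR]

lemma phiR12 : phiR K 1 2 = X 1 * X 2 - X 3 * X 0 := by
  simp [phiR, eps, XR]

lemma phiR22 : phiR K 2 2 = X 2 * X 2 - X 3 * X 1 := by
  simp [phiR, eps, XR]

lemma psiR_coe (hb : b ≤ 3) (j : Fin (4 - b)) : psiR K a d b ((j : ℕ) : ℤ) =
    X ⟨b + j, by omega⟩ * X 3 ^ a - X ⟨j, by omega⟩ * X 0 ^ (a + d) := by
  have h1 : (0 : ℤ) ≤ (b : ℤ) + ((j : ℕ) : ℤ) ∧ (b : ℤ) + ((j : ℕ) : ℤ) < 4 := by omega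
  have h2 : (0 : ℤ) ≤ ((j : ℕ) : ℤ) ∧ ((j : ℕ) : ℤ) < 4 := by omega
  rw [psiR, if_pos (by omega), XR, dif_pos h1, XR, dif_pos (by omega), XR, dif_pos h2, XR,
    dif_pos (by omega)]
  rfl

lemma phib_inl (i : Fin 4) : phib K a d b (X (Sum.inl i)) = Polynomial.C (X i) := by
  simp [phib]

lemma phib_psi (j : Fin (4 - b)) : phib K a d b (X (Sum.inr (Sum.inl j))) =
    Polynomial.C (psiR K a d b ((j : ℕ) : ℤ)) * Polynomial.X := by
  simp [phib]

lemma phib_phi0 : phib K a d b (X (Sum.inr (Sum.inr 0))) =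
    Polynomial.C (X 2 * X 2 - X 3 * X 1) * Polynomial.X := by
  simp [phib, phiR22]

lemma phib_phi1 : phib K a d b (X (Sum.inr (Sum.inr 1))) =
    Polynomial.C (X 1 * X 2 - X 3 * X 0) * Polynomial.X := by
  simp [phib, phiR12]

lemma phib_phi2 : phib K a d b (X (Sum.inr (Sum.inr 2))) =
    Polynomial.C (X 1 * X 1 - X 2 * X 0) * Polynomial.X := by
  simp [phib, phiR11]

lemma natDegree_le_of_FF {A : Type} [CommRing A] [Algebra K A]
    (T : Rb K b →ₐ[K] Polynomial A)
    (h1 : ∀ i, (T (X (Sum.inl i))).natDegree ≤ 0)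
    (h2 : ∀ i, (T (X (Sum.inr (Sum.inl i)))).natDegree ≤ 1)
    (h3 : ∀ i, (T (X (Sum.inr (Sum.inr i)))).natDegree ≤ 0)
    (N : ℕ) (g : Rb K b) (hg : g ∈ FF K b (N + 1)) : (T g).natDegree ≤ N := by
  have key : ∀ s : Multiset (Vb b), (T (monomial (Multiset.toFinsupp s) 1)).natDegree ≤
      wt b (Multiset.toFinsupp s) := by
    intro s
    induction s using Multiset.induction_on with
    | empty => rw [map_zero, monomial_zero', C_1, map_one, Polynomial.natDegree_one]; omega
    | cons v s ih =>
      rw [← Multiset.singleton_add, map_add, Multiset.toFinsupp_singleton, wt_add]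
      generalize Multiset.toFinsupp s = m at ih ⊢
      have hX : (monomial (Finsupp.single v 1 + m) 1 : Rb K b) = X v * monomial m 1 := by
        rw [X, monomial_mul, one_mul]
      rw [hX, map_mul, wt_single]
      refine Polynomial.natDegree_mul_le.trans (Nat.add_le_add ?_ ih)
      rcases v with v | v | v
      · exact h1 v
      · exact h2 v
      · exact h3 v
  unfold FF at hg
  induction hg using Submodule.span_induction with
  | mem g hg =>
    obtain ⟨m, hm, rfl⟩ := hg
    obtain ⟨s, rfl⟩ := Multiset.toFinsupp.surjective m
    exact (key s).trans (by omega)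
  | zero => simp
  | add x y _ _ hx hy =>
    rw [map_add]
    exact (Polynomial.natDegree_add_le _ _).trans (max_le hx hy)
  | smul c x _ hx =>
    rw [map_smul]
    exact (Polynomial.natDegree_smul_le _ _).trans hx

lemma coeff_dvd_of_root {L : Type} [Field L] (P : Polynomial (Polynomial L)) (N : ℕ)
    (hN : P.natDegree ≤ N)
    (h : P.eval₂ (algebraMap (Polynomial L) (FractionRing (Polynomial L)))
      (algebraMap (Polynomial L) (FractionRing (Polynomial L)) Polynomial.X)⁻¹ = 0) :
    (P.coeff N).eval 0 = 0 := by
  set i := algebraMap (Polynomial L) (FractionRing (Polynomial L)) with hi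
  have hinj : Function.Injective i := IsFractionRing.injective _ _
  have hX : i Polynomial.X ≠ 0 := by
    rw [Ne, map_eq_zero_iff i hinj]; exact Polynomial.X_ne_zero
  letI := invertibleOfNonzero (inv_ne_zero hX)
  have h1 := Polynomial.eval₂_reflect_mul_pow i (i Polynomial.X)⁻¹ N P hN
  rw [h, invOf_eq_inv, inv_inv] at h1
  have h2 : (Polynomial.reflect N P).eval₂ i (i Polynomial.X) = 0 := by
    rcases mul_eq_zero.1 h1 with h | h
    · exact h
    · exact absurd h (pow_ne_zero _ (inv_ne_zero hX))
  rw [Polynomial.eval₂_at_apply, map_eq_zero_iff i hinj] at h2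
  have h3 := congrArg (Polynomial.eval 0) h2
  rw [Polynomial.eval_zero] at h3
  have h4 : ∀ Q : Polynomial (Polynomial L),
      Polynomial.eval 0 (Polynomial.eval Polynomial.X Q) = (Q.coeff 0).eval 0 := by
    intro Q
    induction Q using Polynomial.induction_on' with
    | add p q hp hq => simp [hp, hq]
    | monomial n c =>
      rw [Polynomial.eval_monomial, Polynomial.coeff_monomial]
      rcases n with _ | n <;> simp
  rw [h4, Polynomial.coeff_reflect] at h3
  simpa [Polynomial.revAt_le] using h3

section point

variable {L : Type} [Field L] [Algebra K L] (s t p q : L)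

/-- The curve of points. -/
def xe : Fin 4 → Polynomial L :=
  ![Polynomial.C (s ^ 3), Polynomial.C (s ^ 2 * t),
    Polynomial.C (s * t ^ 2) + Polynomial.X * Polynomial.C (-p / s ^ 3),
    Polynomial.C (t ^ 3) + Polynomial.X * Polynomial.C ((s ^ 2 * t * (-p / s ^ 3) - q) / s ^ 3)]

/-- The limiting value of `Φ(2,2)`. -/
def r0 : L := 2 * (s * t ^ 2) * (-p / s ^ 3) - s ^ 2 * t * ((s ^ 2 * t * (-p / s ^ 3) - q) / s ^ 3)

/-- The specialization along the curve. -/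
def Lam2 : Rb K b →ₐ[K] Polynomial (Polynomial L) :=
  aeval fun v =>
    match v with
    | Sum.inl i => Polynomial.C (xe s t p q i)
    | Sum.inr (Sum.inl j) =>
        Polynomial.C (aeval (xe s t p q) (psiR K a d b ((j : ℕ) : ℤ))) * Polynomial.X
    | Sum.inr (Sum.inr k) =>
        Polynomial.C (if k = 0 then Polynomial.C (r0 s t p q) +
          Polynomial.X * Polynomial.C ((-p / s ^ 3) ^ 2) else if k = 1 then Polynomial.C q
          else Polynomial.C p)

lemma Lam2_psi (j : Fin (4 - b)) : Lam2 K a d b s t p q (X (Sum.inr (Sum.inl j))) =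
    Polynomial.C (aeval (xe s t p q) (psiR K a d b ((j : ℕ) : ℤ))) * Polynomial.X := by
  simp only [Lam2, aeval_X]

lemma r0_eq (hs : s ≠ 0) : s ^ 2 * r0 s t p q = s * t * q - t ^ 2 * p := by
  rw [r0]; field_simp; ring

lemma phi11_xe (hs : s ≠ 0) : xe s t p q 1 * xe s t p q 1 - xe s t p q 2 * xe s t p q 0 =
    Polynomial.X * Polynomial.C p := by
  have h : p = - (s ^ 3 * (-p / s ^ 3)) := by field_simp
  conv_rhs => rw [h]
  simp [xe]; ring

lemma phi12_xe (hs : s ≠ 0) : xe s t p q 1 * xe s t p q 2 - xe s t p q 3 * xe s t p q 0 =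
    Polynomial.X * Polynomial.C q := by
  have h : q = s ^ 2 * t * (-p / s ^ 3) -
    s ^ 3 * ((s ^ 2 * t * (-p / s ^ 3) - q) / s ^ 3) := by field_simp; ring
  conv_rhs => rw [h]
  simp only [xe, Matrix.cons_val, map_mul, map_sub, map_pow]; ring

lemma phi22_xe : xe s t p q 2 * xe s t p q 2 - xe s t p q 3 * xe s t p q 1 =
    Polynomial.X * (Polynomial.C (r0 s t p q) + Polynomial.X * Polynomial.C ((-p / s ^ 3) ^ 2)) := by
  simp only [xe, r0, Matrix.cons_val, map_mul, map_sub, map_pow, map_ofNat]; ring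

lemma Lam2_root (hs : s ≠ 0) (g : Rb K b) (hg : phib K a d b g = 0) :
    (Lam2 K a d b s t p q g).eval₂ (algebraMap (Polynomial L) (FractionRing (Polynomial L)))
      (algebraMap (Polynomial L) (FractionRing (Polynomial L)) Polynomial.X)⁻¹ = 0 := by
  set i := algebraMap (Polynomial L) (FractionRing (Polynomial L)) with hi
  have hinj : Function.Injective i := IsFractionRing.injective _ _
  have hX : i Polynomial.X ≠ 0 := by
    rw [Ne, map_eq_zero_iff i hinj]; exact Polynomial.X_ne_zero
  have hh : (Polynomial.eval₂RingHom i (i Polynomial.X)⁻¹).comp (Lam2 K a d b s t p q).toRingHom =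
      (Polynomial.eval₂RingHom (i.comp (aeval (R := K) (xe s t p q)).toRingHom)
        (i Polynomial.X)⁻¹).comp (phib K a d b).toRingHom := by
    apply MvPolynomial.ringHom_ext
    · intro c
      simp [Lam2, phib, Polynomial.algebraMap_apply, algebraMap_eq]
    · rintro (v | v | v)
      · simp [phib_inl, Lam2]
      · change Polynomial.eval₂ i _ (Lam2 K a d b s t p q _) =
          Polynomial.eval₂ _ _ (phib K a d b _)
        rw [Lam2_psi, phib_psi, Polynomial.eval₂_mul, Polynomial.eval₂_mul, Polynomial.eval₂_C,
          Polynomial.eval₂_C, Polynomial.eval₂_X, Polynomial.eval₂_X]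
        rfl
      · have e0 := congrArg i (phi22_xe s t p q)
        have e1 := congrArg i (phi12_xe s t p q hs)
        have e2 := congrArg i (phi11_xe s t p q hs)
        simp only [map_sub, map_mul] at e0 e1 e2
        fin_cases v
        · simp [phib_phi0, Lam2, -map_add, e0]
          field_simp
        · simp [phib_phi1, Lam2, e1]
          field_simp
        · simp [phib_phi2, Lam2, e2]
          field_simp
  have := congrArg (fun f => f g) hh
  simpa [hg] using this

lemma xe_zero (k : Fin 4) : (xe s t p q k).eval 0 = s ^ (3 - (k : ℕ)) * t ^ (k : ℕ) := by
  fin_cases k <;> simp [xe]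

lemma Lam2_zero (hb : b ≤ 3) (g : Rb K b) : (Lam2 K a d b s t p q g).map (Polynomial.evalRingHom 0) =
    ((Lam K b g).map (aeval (R := K) (![s, t, p, q, r0 s t p q] : Fin 5 → L)).toRingHom).comp
      (Polynomial.C (t ^ (3 * a + b) - s ^ (3 * (a + d) + b)) * Polynomial.X) := by
  have hh : (Polynomial.mapRingHom (Polynomial.evalRingHom (0 : L))).comp
      (Lam2 K a d b s t p q).toRingHom =
      (Polynomial.compRingHom
        (Polynomial.C (t ^ (3 * a + b) - s ^ (3 * (a + d) + b)) * Polynomial.X)).comp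
      ((Polynomial.mapRingHom
        (aeval (R := K) (![s, t, p, q, r0 s t p q] : Fin 5 → L)).toRingHom).comp
        (Lam K b).toRingHom) := by
    apply MvPolynomial.ringHom_ext
    · intro c
      simp [Lam2, Lam, Polynomial.algebraMap_apply, algebraMap_eq]
    · rintro (v | v | v)
      · simp [Lam2, Lam, xe_zero]
      · have hv := v.2
        have h1 : (aeval (xe s t p q) (psiR K a d b ((v : ℕ) : ℤ)) : Polynomial L).eval 0 =
            s ^ (3 - b - (v : ℕ)) * t ^ (v : ℕ) * (t ^ (3 * a + b) - s ^ (3 * (a + d) + b)) := by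
          rw [psiR_coe K a d b hb]
          simp only [map_sub, map_mul, map_pow, aeval_X, Polynomial.eval_sub, Polynomial.eval_mul,
            Polynomial.eval_pow, xe_zero]
          obtain ⟨c, hc⟩ : ∃ c, 3 - b - (v : ℕ) = c := ⟨_, rfl⟩
          have h3 : 3 - (v : ℕ) = c + b := by omega
          have h4 : 3 - (b + (v : ℕ)) = c := by omega
          rw [hc, h3, h4]
          simp
          ring
        change Polynomial.map _ (Lam2 K a d b s t p q _) = _
        rw [Lam2_psi, Polynomial.map_mul, Polynomial.map_C, Polynomial.map_X,
          Polynomial.coe_evalRingHom, h1]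
        simp [Lam]
        ring
      · fin_cases v
        · simp [Lam2, Lam]
        · simp [Lam2, Lam]
        · simp [Lam2, Lam]
  have := congrArg (fun f => f g) hh
  simpa using this

end point

lemma dvd_of_ker (hb : b ≤ 3) (hb1 : 1 ≤ b) (N : ℕ) (g : Rb K b) (hg : phib K a d b g = 0)
    (hF : g ∈ FF K b (N + 1)) : ell K ∣ (Lam K b g).coeff N := by
  let L := FractionRing (MvPolynomial (Fin 4) K)
  let pt : Fin 4 → L := fun i => algebraMap (MvPolynomial (Fin 4) K) L (X i)
  have hae : ∀ F : MvPolynomial (Fin 4) K, aeval (R := K) pt F =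
      algebraMap (MvPolynomial (Fin 4) K) L F := by
    intro F
    have : (aeval (R := K) pt) = IsScalarTower.toAlgHom K (MvPolynomial (Fin 4) K) L := by
      apply MvPolynomial.algHom_ext
      intro i
      simp [pt]
    rw [this]; rfl
  have hinj : Function.Injective (aeval (R := K) pt) := by
    intro x y hxy
    rw [hae, hae] at hxy
    exact IsFractionRing.injective _ _ hxy
  have hs : pt 0 ≠ 0 := by
    have : aeval (R := K) pt (X 0) ≠ 0 := by
      rw [Ne, map_eq_zero_iff _ hinj]; exact X_ne_zero _
    simpa using this
  have hf : pt 1 ^ (3 * a + b) - pt 0 ^ (3 * (a + d) + b) ≠ 0 := by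
    have : aeval (R := K) pt (X 1 ^ (3 * a + b) - X 0 ^ (3 * (a + d) + b)) ≠ 0 := by
      rw [Ne, map_eq_zero_iff _ hinj]
      intro h
      have := congrArg (eval (![0, 1, 0, 0] : Fin 4 → K)) h
      have hne : 3 * (a + d) + b ≠ 0 := by omega
      simp at this
      rw [zero_pow hne] at this
      simp at this
    simpa using this
  have hroot := Lam2_root K a d b (pt 0) (pt 1) (pt 2) (pt 3) hs g hg
  have hdeg : (Lam2 K a d b (pt 0) (pt 1) (pt 2) (pt 3) g).natDegree ≤ N := by
    apply natDegree_le_of_FF K b _ _ _ _ N g hF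
    · intro i; simp [Lam2]
    · intro i
      simp only [Lam2, aeval_X]
      exact (Polynomial.natDegree_C_mul_le _ _).trans (Polynomial.natDegree_X_le)
    · intro i; simp [Lam2]
  have h0 := coeff_dvd_of_root _ N hdeg hroot
  have h1 := congrArg (fun P => Polynomial.coeff P N)
    (Lam2_zero K a d b (pt 0) (pt 1) (pt 2) (pt 3) hb g)
  simp only [Polynomial.coeff_map, Polynomial.comp_C_mul_X_coeff, Polynomial.coe_evalRingHom] at h1
  rw [h0] at h1
  have h2 := (mul_eq_zero.1 h1.symm).resolve_right (pow_ne_zero _ hf)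
  exact ell_dvd_of_theta K pt hinj _ (r0 (pt 0) (pt 1) (pt 2) (pt 3))
    (by rw [r0_eq _ _ _ _ hs]) h2

/-- The inclusion of the `Ψ`-free polynomials. -/
def j7 : MvPolynomial (Fin 7) K →ₐ[K] Rb K b :=
  aeval ![X (Sum.inl 0), X (Sum.inl 1), X (Sum.inl 2), X (Sum.inl 3), X (Sum.inr (Sum.inr 2)),
    X (Sum.inr (Sum.inr 1)), X (Sum.inr (Sum.inr 0))]

lemma mem_range_j7 (g : Rb K b) (hg : g ∈ FF K b 1) : g ∈ (j7 K b).range := by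
  have key : ∀ s : Multiset (Vb b), wt b (Multiset.toFinsupp s) < 1 →
      (monomial (Multiset.toFinsupp s) 1 : Rb K b) ∈ (j7 K b).range := by
    intro s
    induction s using Multiset.induction_on with
    | empty => intro _; rw [map_zero, monomial_zero', C_1]; exact one_mem _
    | cons v s ih =>
      rw [← Multiset.singleton_add, map_add, Multiset.toFinsupp_singleton, wt_add]
      generalize Multiset.toFinsupp s = m at ih ⊢
      have hX : (monomial (Finsupp.single v 1 + m) 1 : Rb K b) = X v * monomial m 1 := by
        rw [X, monomial_mul, one_mul]
      rw [hX, wt_single]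
      intro h
      refine mul_mem ?_ (ih (by omega))
      rcases v with v | v | v
      · fin_cases v
        · exact ⟨X 0, by simp [j7]⟩
        · exact ⟨X 1, by simp [j7]⟩
        · exact ⟨X 2, by simp [j7]⟩
        · exact ⟨X 3, by simp [j7]⟩
      · simp at h
      · fin_cases v
        · exact ⟨X 6, by simp [j7]⟩
        · exact ⟨X 5, by simp [j7]⟩
        · exact ⟨X 4, by simp [j7]⟩
  unfold FF at hg
  induction hg using Submodule.span_induction with
  | mem g hg =>
    obtain ⟨m, hm, rfl⟩ := hg
    obtain ⟨s, rfl⟩ := Multiset.toFinsupp.surjective m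
    exact key s hm
  | zero => exact zero_mem _
  | add x y _ _ hx hy => exact add_mem hx hy
  | smul c x _ hx => exact Subalgebra.smul_mem _ hx c

lemma mem_of_base (I : Ideal (Rb K b)) (hI : GoodIdeal K b I) (g : Rb K b)
    (hg : phib K a d b g = 0) (hF : g ∈ FF K b 1) : g ∈ I := by
  obtain ⟨c, rfl⟩ := mem_range_j7 K b g hF
  have hcI : c ∈ IL K := by
    let L := FractionRing (MvPolynomial (Fin 5) K)
    let pt : Fin 5 → L := fun i => algebraMap (MvPolynomial (Fin 5) K) L (X i)
    have hae : ∀ F : MvPolynomial (Fin 5) K, aeval (R := K) pt F =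
        algebraMap (MvPolynomial (Fin 5) K) L F := by
      intro F
      have : (aeval (R := K) pt) = IsScalarTower.toAlgHom K (MvPolynomial (Fin 5) K) L := by
        apply MvPolynomial.algHom_ext
        intro i
        simp [pt]
      rw [this]; rfl
    have hinj : Function.Injective (aeval (R := K) pt) := by
      intro x y hxy
      rw [hae, hae] at hxy
      exact IsFractionRing.injective _ _ hxy
    have hp : pt 2 ≠ 0 := by
      have : aeval (R := K) pt (X 2) ≠ 0 := by
        rw [Ne, map_eq_zero_iff _ hinj]; exact X_ne_zero _
      simpa using this
    have hdd : pt 2 * pt 1 ^ 2 - pt 0 * pt 1 * pt 3 + pt 0 ^ 2 * pt 4 ≠ 0 := by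
      have : aeval (R := K) pt (X 2 * X 1 ^ 2 - X 0 * X 1 * X 3 + X 0 ^ 2 * X 4) ≠ 0 := by
        rw [Ne, map_eq_zero_iff _ hinj]
        intro h
        have := congrArg (eval (![0, 1, 1, 0, 0] : Fin 5 → K)) h
        simp at this
      simpa using this
    have hpt : pt = ![pt 0, pt 1, pt 2, pt 3, pt 4] := by
      funext i; fin_cases i <;> rfl
    rw [hpt] at hinj
    generalize pt 0 = w at *
    generalize pt 1 = x at *
    generalize pt 2 = p at *
    generalize pt 3 = q at *
    generalize pt 4 = r at *
    obtain ⟨y, hy⟩ : ∃ y, p * y = x * q - w * r := ⟨p⁻¹ * (x * q - w * r), mul_inv_cancel_left₀ hp _⟩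
    obtain ⟨z, hz⟩ : ∃ z, p * z = y * q - x * r := ⟨p⁻¹ * (y * q - x * r), mul_inv_cancel_left₀ hp _⟩
    have hδ : x * x - y * w ≠ 0 := by
      intro h
      apply hdd
      linear_combination p * h + w * hy
    obtain ⟨T, hT⟩ : ∃ T, (x * x - y * w) * T = p := ⟨(x * x - y * w)⁻¹ * p, mul_inv_cancel_left₀ hδ _⟩
    have e1 : (x * y - z * w) * T = q := by
      apply mul_left_cancel₀ hδ
      linear_combination (x * y - z * w) * hT + x * hy - w * hz
    have e0 : (y * y - z * x) * T = r := by
      apply mul_left_cancel₀ hδ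
      linear_combination (y * y - z * x) * hT + y * hy - x * hz
    apply mem_IL_of_eval K ![w, x, y, z, p, q, r] _ _ _ c
    · have hh : ((Polynomial.eval₂RingHom (aeval (R := K) ![w, x, y, z]).toRingHom T).comp
          (phib K a d b).toRingHom).comp (j7 K b).toRingHom =
          (aeval (R := K) (![w, x, y, z, p, q, r] : Fin 7 → L)).toRingHom := by
        apply MvPolynomial.ringHom_ext
        · intro c
          simp [j7, phib, algebraMap_eq]
        · intro v
          fin_cases v
          · simp [j7, phib_inl]
          · simp [j7, phib_inl]
          · simp [j7, phib_inl]
          · simp [j7, phib_inl]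
          · simp [j7, phib_phi2, hT]
          · simp [j7, phib_phi1, e1]
          · simp [j7, phib_phi0, e0]
      have := congrArg (fun f => f c) hh
      have hg' : phib K a d b (j7 K b c) = 0 := hg
      simpa [hg'] using this.symm
    · simpa using hinj
    · simp; linear_combination hy
    · simp; linear_combination hz
  have hle : (IL K).map (j7 K b).toRingHom ≤ I := by
    rw [IL, Ideal.map_span, Ideal.span_le]
    have hX : ∀ i : Fin 4, Xv K b ((i : ℕ) : ℤ) = X (Sum.inl i) := Xv_coe K b
    have h0 := hX 0
    have h1 := hX 1
    have h2 := hX 2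
    have h3 := hX 3
    have hl0 := hI.hL 0 (by omega)
    have hl1 := hI.hL 1 (by omega)
    simp at h0 h1 h2 h3 hl0 hl1
    norm_num at hl1
    rw [h0, h1, h2] at hl0
    rw [h1, h2, h3] at hl1
    rintro _ ⟨f, hf | hf, rfl⟩
    · subst hf
      simpa [j7] using hl0
    · rw [Set.mem_singleton_iff] at hf
      subst hf
      simpa [j7] using hl1
  exact hle (Ideal.mem_map_of_mem (j7 K b).toRingHom hcI)

end Special

section Final

lemma memA (i : ℤ) (hi : i = 1 ∨ i = 2 ∨ i = 3) (j : ℕ) (hj : j ≤ 2 - b) :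
    Ap K a d b i (j : ℤ) ∈ Ideal.span (smallGenSet K a d b) :=
  Ideal.subset_span (Or.inl (Or.inl ⟨i, by simpa using hi, j, hj, rfl⟩))

lemma memL0 : Lp K b 0 ∈ Ideal.span (smallGenSet K a d b) :=
  Ideal.subset_span (Or.inl (Or.inr (by simp)))

lemma memL1 : Lp K b 1 ∈ Ideal.span (smallGenSet K a d b) :=
  Ideal.subset_span (Or.inl (Or.inr (by simp)))

lemma memQ1 : Qp K a d b 1 ∈ Ideal.span (smallGenSet K a d b) :=
  Ideal.subset_span (Or.inr (by split_ifs <;> simp))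

lemma memQ2 (hb : b = 1) : Qp K a d b 2 ∈ Ideal.span (smallGenSet K a d b) :=
  Ideal.subset_span (Or.inr (by rw [if_pos hb]; simp))

lemma A110 : Ap K a d 1 1 (0 : ℕ) = Xv K 1 1 * Psi K 1 0 - Xv K 1 0 * Psi K 1 1
    - Xv K 1 3 ^ a * Phi K 1 1 1 := by
  simp [Ap, eps, Phi]

lemma A210 : Ap K a d 1 2 (0 : ℕ) = Xv K 1 2 * Psi K 1 0 - Xv K 1 0 * Psi K 1 2
    - Xv K 1 3 ^ a * Phi K 1 1 2 := by
  simp [Ap, eps, Phi]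

lemma A310 : Ap K a d 1 3 (0 : ℕ) = Xv K 1 3 * Psi K 1 0 - Xv K 1 1 * Psi K 1 2
    - Xv K 1 0 ^ (a + d) * Phi K 1 1 2 := by
  simp [Ap, eps, Phi, sub_eq_add_neg]

lemma A111 : Ap K a d 1 1 (1 : ℕ) = Xv K 1 1 * Psi K 1 1 - Xv K 1 0 * Psi K 1 2
    - Xv K 1 3 ^ a * Phi K 1 1 2 + Xv K 1 0 ^ (a + d) * Phi K 1 1 1 := by
  simp [Ap, eps, Phi]

lemma A211 : Ap K a d 1 2 (1 : ℕ) = Xv K 1 2 * Psi K 1 1 - Xv K 1 1 * Psi K 1 2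
    - Xv K 1 3 ^ a * Phi K 1 2 2 := by
  simp [Ap, eps, Phi]

lemma A311 : Ap K a d 1 3 (1 : ℕ) = Xv K 1 3 * Psi K 1 1 - Xv K 1 2 * Psi K 1 2
    - Xv K 1 0 ^ (a + d) * Phi K 1 2 2 := by
  simp [Ap, eps, Phi, sub_eq_add_neg]

lemma A120 : Ap K a d 2 1 (0 : ℕ) = Xv K 2 1 * Psi K 2 0 - Xv K 2 0 * Psi K 2 1
    - Xv K 2 3 ^ a * Phi K 2 1 2 := by
  simp [Ap, eps, Phi]

lemma A220 : Ap K a d 2 2 (0 : ℕ) = Xv K 2 2 * Psi K 2 0 - Xv K 2 1 * Psi K 2 1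
    - Xv K 2 3 ^ a * Phi K 2 2 2 - Xv K 2 0 ^ (a + d) * Phi K 2 1 1 := by
  simp [Ap, eps, Phi, sub_eq_add_neg]

lemma A320 : Ap K a d 2 3 (0 : ℕ) = Xv K 2 3 * Psi K 2 0 - Xv K 2 2 * Psi K 2 1
    - Xv K 2 0 ^ (a + d) * Phi K 2 1 2 := by
  simp [Ap, eps, Phi, sub_eq_add_neg]

variable {K b} in
lemma low_WW {r : Rb K b} (hr : HH K b 0 r) (I : Ideal (Rb K b)) : r ∈ WW K b I 1 := hr.mem_WW I

variable {K b} in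
lemma low_WW2 {r : Rb K b} (hr : HH K b 1 r) (I : Ideal (Rb K b)) : r ∈ WW K b I 2 := hr.mem_WW I

variable {K b} in
lemma low_WW2_zero {r : Rb K b} (hr : HH K b 0 r) (I : Ideal (Rb K b)) : r ∈ WW K b I 2 :=
  mem_WW_of_FF (FF_mono (by omega) hr.mem_FF)

variable {K b} in
lemma HH_mul_one_zero {r s : Rb K b} (hr : HH K b 1 r) (hs : HH K b 0 s) : HH K b 1 (r * s) := by
  have := HH_mul hr hs
  rwa [Nat.add_zero] at this

variable {K b} in
lemma HH_mul_zero_one {r s : Rb K b} (hr : HH K b 0 r) (hs : HH K b 1 s) : HH K b 1 (r * s) := by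
  have := HH_mul hr hs
  rwa [Nat.zero_add] at this

lemma HXa (i j k : ℤ) (n : ℕ) : HH K b 0 (Xv K b i ^ n * Phi K b j k) :=
  HH_mul_zero (HH_pow_zero (HH_Xv _) _) (HH_Phi _ _)

lemma Phi11 : Phi K b 1 1 = X (Sum.inr (Sum.inr 2)) := by simp [Phi]
lemma Phi12 : Phi K b 1 2 = X (Sum.inr (Sum.inr 1)) := by simp [Phi]
lemma Phi22 : Phi K b 2 2 = X (Sum.inr (Sum.inr 0)) := by simp [Phi]

lemma hL_aux (i : ℕ) (hi : i < 2) : Xv K b i * X (Sum.inr (Sum.inr 0)) -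
    Xv K b (i + 1 : ℕ) * X (Sum.inr (Sum.inr 1)) +
    Xv K b (i + 2 : ℕ) * X (Sum.inr (Sum.inr 2)) ∈ Ideal.span (smallGenSet K a d b) := by
  rw [← Phi11, ← Phi12, ← Phi22]
  interval_cases i
  · have := memL0 K a d b
    rwa [Lp, if_pos (Or.inl rfl)] at this
  · have := memL1 K a d b
    rwa [Lp, if_pos (Or.inr rfl)] at this

lemma good_one : GoodIdeal K 1 (Ideal.span (smallGenSet K a d 1)) := by
  set I := Ideal.span (smallGenSet K a d 1) with hI
  have m1 := mem_WW_of_mem (N := 1) (memA K a d 1 1 (by simp) 0 (by simp))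
  have m2 := mem_WW_of_mem (N := 1) (memA K a d 1 2 (by simp) 0 (by simp))
  have m3 := mem_WW_of_mem (N := 1) (memA K a d 1 3 (by simp) 0 (by simp))
  have n1 := mem_WW_of_mem (N := 1) (memA K a d 1 1 (by simp) 1 (by simp))
  have n2 := mem_WW_of_mem (N := 1) (memA K a d 1 2 (by simp) 1 (by simp))
  have n3 := mem_WW_of_mem (N := 1) (memA K a d 1 3 (by simp) 1 (by simp))
  rw [A110, ← hI] at m1
  rw [A210, ← hI] at m2
  rw [A310, ← hI] at m3
  rw [A111, ← hI] at n1
  rw [A211, ← hI] at n2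
  rw [A311, ← hI] at n3
  have l : ∀ (i j k : ℤ) (n : ℕ), Xv K 1 i ^ n * Phi K 1 j k ∈ WW K 1 I 1 :=
    fun i j k n => low_WW (HXa K 1 i j k n) I
  have q2 := mem_WW_of_mem (N := 2) (memQ2 K a d 1 rfl)
  have q1 := mem_WW_of_mem (N := 1) (memQ1 K a d 1)
  rw [Qp, if_neg (by simp), if_pos ⟨rfl, rfl⟩, ← hI] at q2
  rw [Qp, if_pos ⟨rfl, rfl⟩, ← hI] at q1
  have hq2 : Psi K 1 1 * Psi K 1 1 - Psi K 1 0 * Psi K 1 2 ∈ WW K 1 I 2 := by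
    have a1 := low_WW2 (HH_mul_one_zero (HH_mul_zero_one (HH_pow_zero (HH_Xv (K := K) (b := 1) 3) (a - 1))
      (HH_Psi 2)) (HH_Phi 2 2)) I
    have a2 := low_WW2 (HH_mul_one_zero (HH_mul_zero_one
      (HH_pow_zero (HH_Xv (K := K) (b := 1) 0) (a + d - 1)) (HH_Psi 0)) (HH_Phi 1 1)) I
    have hX := HH_mul_zero (HH_pow_zero (HH_Xv (K := K) (b := 1) 3) (a - 1))
      (HH_pow_zero (HH_Xv (K := K) (b := 1) 0) (a + d - 1))
    have a3 := low_WW2_zero (HH_mul_zero hX (HH_pow_zero (HH_Phi 1 2) 2)) I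
    have a4 := low_WW2_zero (HH_mul_zero hX (HH_mul_zero (HH_Phi 2 2) (HH_Phi 1 1))) I
    convert add_mem (sub_mem (add_mem q2 a1) a2) (sub_mem a3 a4) using 1
    ring
  refine ⟨Or.inl rfl, ?_, ?_, hL_aux K a d 1, ?_, fun h => by omega⟩
  · intro i j hi hj
    interval_cases i <;> interval_cases j
    · change Xv K 1 1 * Psi K 1 0 - Xv K 1 0 * Psi K 1 1 ∈ _
      convert add_mem m1 (l 3 1 1 a) using 1
      ring
    · change Xv K 1 1 * Psi K 1 1 - Xv K 1 0 * Psi K 1 2 ∈ _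
      convert sub_mem (add_mem n1 (l 3 1 2 a)) (l 0 1 1 (a + d)) using 1
      ring
    · change Xv K 1 2 * Psi K 1 0 - Xv K 1 1 * Psi K 1 1 ∈ _
      convert add_mem (sub_mem m2 n1) (l 0 1 1 (a + d)) using 1
      ring
    · change Xv K 1 2 * Psi K 1 1 - Xv K 1 1 * Psi K 1 2 ∈ _
      convert add_mem n2 (l 3 2 2 a) using 1
      ring
    · change Xv K 1 3 * Psi K 1 0 - Xv K 1 2 * Psi K 1 1 ∈ _
      convert sub_mem (add_mem (sub_mem m3 n2) (l 0 1 2 (a + d))) (l 3 2 2 a) using 1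
      ring
    · change Xv K 1 3 * Psi K 1 1 - Xv K 1 2 * Psi K 1 2 ∈ _
      convert add_mem n3 (l 0 2 2 (a + d)) using 1
      ring
  · intro i j hi hj
    interval_cases i <;> interval_cases j
    · convert Submodule.zero_mem (WW K 1 I 2) using 1
      ring
    · exact hq2
    · rw [← neg_mem_iff]
      change -(Psi K 1 2 * Psi K 1 0 - Psi K 1 1 * Psi K 1 1) ∈ _
      convert hq2 using 1
      ring
    · convert Submodule.zero_mem (WW K 1 I 2) using 1
      ring
  · intro _
    rw [← Phi11, ← Phi12, ← Phi22]
    change Psi K 1 0 * Phi K 1 2 2 - Psi K 1 1 * Phi K 1 1 2 + Psi K 1 2 * Phi K 1 1 1 ∈ _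
    convert q1 using 1
    ring

lemma good_two : GoodIdeal K 2 (Ideal.span (smallGenSet K a d 2)) := by
  set I := Ideal.span (smallGenSet K a d 2) with hI
  have m1 := mem_WW_of_mem (N := 1) (memA K a d 2 1 (by simp) 0 (by simp))
  have m2 := mem_WW_of_mem (N := 1) (memA K a d 2 2 (by simp) 0 (by simp))
  have m3 := mem_WW_of_mem (N := 1) (memA K a d 2 3 (by simp) 0 (by simp))
  rw [A120, ← hI] at m1
  rw [A220, ← hI] at m2
  rw [A320, ← hI] at m3
  have l : ∀ (i j k : ℤ) (n : ℕ), Xv K 2 i ^ n * Phi K 2 j k ∈ WW K 2 I 1 :=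
    fun i j k n => low_WW (HXa K 2 i j k n) I
  have q1 := mem_WW_of_mem (N := 2) (memQ1 K a d 2)
  rw [Qp, if_neg (by simp), if_neg (by simp), if_pos ⟨rfl, rfl⟩, ← hI] at q1
  refine ⟨Or.inr rfl, ?_, ?_, hL_aux K a d 2, fun h => by omega, ?_⟩
  · intro i j hi hj
    interval_cases i <;> interval_cases j
    · change Xv K 2 1 * Psi K 2 0 - Xv K 2 0 * Psi K 2 1 ∈ _
      convert add_mem m1 (l 3 1 2 a) using 1
      ring
    · change Xv K 2 2 * Psi K 2 0 - Xv K 2 1 * Psi K 2 1 ∈ _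
      convert add_mem (add_mem m2 (l 3 2 2 a)) (l 0 1 1 (a + d)) using 1
      ring
    · change Xv K 2 3 * Psi K 2 0 - Xv K 2 2 * Psi K 2 1 ∈ _
      convert add_mem m3 (l 0 1 2 (a + d)) using 1
      ring
  · intro i j hi hj
    interval_cases i <;> interval_cases j
    convert Submodule.zero_mem (WW K 2 I 2) using 1
    ring
  · intro _
    rw [← Phi11, ← Phi12, ← Phi22]
    change Psi K 2 0 * Psi K 2 0 * Phi K 2 2 2 - Psi K 2 0 * Psi K 2 1 * Phi K 2 1 2 +
      Psi K 2 1 * Psi K 2 1 * Phi K 2 1 1 ∈ _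
    have a1 := low_WW2 (HH_mul_one_zero (HH_mul_zero_one (HH_pow_zero (HH_Xv (K := K) (b := 2) 3) (a - 1))
      (HH_Psi 1)) (HH_pow_zero (HH_Phi 2 2) 2)) I
    have a2 := low_WW2 (HH_mul_one_zero (HH_mul_zero_one
      (HH_pow_zero (HH_Xv (K := K) (b := 2) 0) (a + d - 1)) (HH_Psi 0))
      (HH_pow_zero (HH_Phi 1 1) 2)) I
    have hX := HH_mul_zero (HH_pow_zero (HH_Xv (K := K) (b := 2) 3) (a - 1))
      (HH_pow_zero (HH_Xv (K := K) (b := 2) 0) (a + d - 1))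
    have a3 := low_WW2_zero (HH_mul_zero hX (HH_pow_zero (HH_Phi 1 2) 3)) I
    have a4 := low_WW2_zero (HH_mul_zero hX (HH_mul_zero (HH_Phi 2 2)
      (HH_mul_zero (HH_Phi 1 2) (HH_Phi 1 1)))) I
    convert add_mem (sub_mem (add_mem q1 a1) a2) (sub_mem a3 a4) using 1
    ring

lemma phib_Xv (i : Fin 4) : phib K a d b (Xv K b ((i : ℕ) : ℤ)) = Polynomial.C (X i) := by
  rw [Xv_coe, phib_inl]

lemma phib_Psi (hb : b ≤ 3) (j : Fin (4 - b)) : phib K a d b (Psi K b ((j : ℕ) : ℤ)) =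
    Polynomial.C (X ⟨b + j, by omega⟩ * X 3 ^ a - X ⟨j, by omega⟩ * X 0 ^ (a + d)) *
      Polynomial.X := by
  rw [Psi_coe, phib_psi, psiR_coe K a d b hb]

lemma ker_common : Lp K b 0 ∈ RingHom.ker (phib K a d b) ∧ Lp K b 1 ∈ RingHom.ker (phib K a d b) ∧
    Dp K b ∈ RingHom.ker (phib K a d b) := by
  have x0 : phib K a d b (Xv K b 0) = Polynomial.C (X 0) := phib_Xv K a d b 0
  have x1 : phib K a d b (Xv K b 1) = Polynomial.C (X 1) := phib_Xv K a d b 1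
  have x2 : phib K a d b (Xv K b 2) = Polynomial.C (X 2) := phib_Xv K a d b 2
  have x3 : phib K a d b (Xv K b 3) = Polynomial.C (X 3) := phib_Xv K a d b 3
  have e1 : (0 : ℤ) + 1 = 1 := rfl
  have e2 : (0 : ℤ) + 2 = 2 := rfl
  have e3 : (1 : ℤ) + 1 = 2 := rfl
  have e4 : (1 : ℤ) + 2 = 3 := rfl
  refine ⟨?_, ?_, ?_⟩
  · rw [RingHom.mem_ker, Lp, if_pos (Or.inl rfl), Phi11, Phi12, Phi22, e1, e2]
    simp only [map_sub, map_add, map_mul, map_pow, x0, x1, x2, phib_phi0, phib_phi1, phib_phi2]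
    ring
  · rw [RingHom.mem_ker, Lp, if_pos (Or.inr rfl), Phi11, Phi12, Phi22, e3, e4]
    simp only [map_sub, map_add, map_mul, map_pow, x1, x2, x3, phib_phi0, phib_phi1, phib_phi2]
    ring
  · rw [RingHom.mem_ker, Dp, Phi11, Phi12]
    simp only [map_sub, map_mul, map_pow, x0, x1, x2, x3, phib_phi1, phib_phi2]
    ring

lemma ker_one (ha : 1 ≤ a) : smallGenSet K a d 1 ⊆ RingHom.ker (phib K a d 1) := by
  have x0 : phib K a d 1 (Xv K 1 0) = Polynomial.C (X 0) := phib_Xv K a d 1 0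
  have x1 : phib K a d 1 (Xv K 1 1) = Polynomial.C (X 1) := phib_Xv K a d 1 1
  have x2 : phib K a d 1 (Xv K 1 2) = Polynomial.C (X 2) := phib_Xv K a d 1 2
  have x3 : phib K a d 1 (Xv K 1 3) = Polynomial.C (X 3) := phib_Xv K a d 1 3
  have p0 : phib K a d 1 (Psi K 1 0) =
    Polynomial.C (X 1 * X 3 ^ a - X 0 * X 0 ^ (a + d)) * Polynomial.X :=
    phib_Psi K a d 1 (by omega) (0 : Fin 3)
  have p1 : phib K a d 1 (Psi K 1 1) =
    Polynomial.C (X 2 * X 3 ^ a - X 1 * X 0 ^ (a + d)) * Polynomial.X :=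
    phib_Psi K a d 1 (by omega) (1 : Fin 3)
  have p2 : phib K a d 1 (Psi K 1 2) =
    Polynomial.C (X 3 * X 3 ^ a - X 2 * X 0 ^ (a + d)) * Polynomial.X :=
    phib_Psi K a d 1 (by omega) (2 : Fin 3)
  obtain ⟨a, rfl⟩ : ∃ a', a = a' + 1 := ⟨a - 1, by omega⟩
  have hd : a + 1 + d - 1 = a + d := by omega
  rintro g ((⟨i, hi, j, hj, rfl⟩ | hg) | hg)
  · simp only [Set.mem_insert_iff, Set.mem_singleton_iff] at hi
    rw [SetLike.mem_coe, RingHom.mem_ker]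
    have hj' : j = 0 ∨ j = 1 := by omega
    rcases hj' with rfl | rfl <;> rcases hi with rfl | rfl | rfl
    · rw [A110]
      simp only [map_sub, map_add, map_mul, map_pow, x0, x1, x2, x3, p0, p1, p2, Phi11, Phi12,
        Phi22, phib_phi0, phib_phi1, phib_phi2]
      ring
    · rw [A210]
      simp only [map_sub, map_add, map_mul, map_pow, x0, x1, x2, x3, p0, p1, p2, Phi11, Phi12,
        Phi22, phib_phi0, phib_phi1, phib_phi2]
      ring
    · rw [A310]
      simp only [map_sub, map_add, map_mul, map_pow, x0, x1, x2, x3, p0, p1, p2, Phi11, Phi12,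
        Phi22, phib_phi0, phib_phi1, phib_phi2]
      ring
    · rw [A111]
      simp only [map_sub, map_add, map_mul, map_pow, x0, x1, x2, x3, p0, p1, p2, Phi11, Phi12,
        Phi22, phib_phi0, phib_phi1, phib_phi2]
      ring
    · rw [A211]
      simp only [map_sub, map_add, map_mul, map_pow, x0, x1, x2, x3, p0, p1, p2, Phi11, Phi12,
        Phi22, phib_phi0, phib_phi1, phib_phi2]
      ring
    · rw [A311]
      simp only [map_sub, map_add, map_mul, map_pow, x0, x1, x2, x3, p0, p1, p2, Phi11, Phi12,
        Phi22, phib_phi0, phib_phi1, phib_phi2]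
      ring
  · obtain ⟨h0, h1, h2⟩ := ker_common K (a + 1) d 1
    simp only [Set.mem_insert_iff, Set.mem_singleton_iff] at hg
    rcases hg with rfl | rfl | rfl
    exacts [h0, h1, h2]
  · rw [if_pos rfl] at hg
    simp only [Set.mem_insert_iff, Set.mem_singleton_iff] at hg
    rw [SetLike.mem_coe, RingHom.mem_ker]
    rcases hg with rfl | rfl
    · rw [Qp, if_pos ⟨rfl, rfl⟩]
      simp only [map_sub, map_add, map_mul, map_pow, x0, x1, x2, x3, p0, p1, p2, Phi11, Phi12,
        Phi22, phib_phi0, phib_phi1, phib_phi2]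
      ring
    · rw [Qp, if_neg (by simp), if_pos ⟨rfl, rfl⟩, hd, Nat.add_sub_cancel]
      simp only [map_sub, map_add, map_mul, map_pow, x0, x1, x2, x3, p0, p1, p2, Phi11, Phi12,
        Phi22, phib_phi0, phib_phi1, phib_phi2]
      ring

lemma ker_two (ha : 1 ≤ a) : smallGenSet K a d 2 ⊆ RingHom.ker (phib K a d 2) := by
  have x0 : phib K a d 2 (Xv K 2 0) = Polynomial.C (X 0) := phib_Xv K a d 2 0
  have x1 : phib K a d 2 (Xv K 2 1) = Polynomial.C (X 1) := phib_Xv K a d 2 1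
  have x2 : phib K a d 2 (Xv K 2 2) = Polynomial.C (X 2) := phib_Xv K a d 2 2
  have x3 : phib K a d 2 (Xv K 2 3) = Polynomial.C (X 3) := phib_Xv K a d 2 3
  have p0 : phib K a d 2 (Psi K 2 0) =
    Polynomial.C (X 2 * X 3 ^ a - X 0 * X 0 ^ (a + d)) * Polynomial.X :=
    phib_Psi K a d 2 (by omega) (0 : Fin 2)
  have p1 : phib K a d 2 (Psi K 2 1) =
    Polynomial.C (X 3 * X 3 ^ a - X 1 * X 0 ^ (a + d)) * Polynomial.X :=
    phib_Psi K a d 2 (by omega) (1 : Fin 2)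
  obtain ⟨a, rfl⟩ : ∃ a', a = a' + 1 := ⟨a - 1, by omega⟩
  have hd : a + 1 + d - 1 = a + d := by omega
  rintro g ((⟨i, hi, j, hj, rfl⟩ | hg) | hg)
  · simp only [Set.mem_insert_iff, Set.mem_singleton_iff] at hi
    rw [SetLike.mem_coe, RingHom.mem_ker]
    obtain rfl : j = 0 := by omega
    rcases hi with rfl | rfl | rfl
    · rw [A120]
      simp only [map_sub, map_add, map_mul, map_pow, x0, x1, x2, x3, p0, p1, Phi11, Phi12,
        Phi22, phib_phi0, phib_phi1, phib_phi2]
      ring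
    · rw [A220]
      simp only [map_sub, map_add, map_mul, map_pow, x0, x1, x2, x3, p0, p1, Phi11, Phi12,
        Phi22, phib_phi0, phib_phi1, phib_phi2]
      ring
    · rw [A320]
      simp only [map_sub, map_add, map_mul, map_pow, x0, x1, x2, x3, p0, p1, Phi11, Phi12,
        Phi22, phib_phi0, phib_phi1, phib_phi2]
      ring
  · obtain ⟨h0, h1, h2⟩ := ker_common K (a + 1) d 2
    simp only [Set.mem_insert_iff, Set.mem_singleton_iff] at hg
    rcases hg with rfl | rfl | rfl
    exacts [h0, h1, h2]
  · rw [if_neg (by simp)] at hg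
    rw [Set.mem_singleton_iff] at hg
    rw [SetLike.mem_coe, RingHom.mem_ker, hg]
    rw [Qp, if_neg (by simp), if_neg (by simp), if_pos ⟨rfl, rfl⟩, hd, Nat.add_sub_cancel]
    simp only [map_sub, map_add, map_mul, map_pow, x0, x1, x2, x3, p0, p1, Phi11, Phi12,
      Phi22, phib_phi0, phib_phi1, phib_phi2]
    ring

lemma ker_eq_of_good (hb : b = 1 ∨ b = 2) (hI : GoodIdeal K b (Ideal.span (smallGenSet K a d b)))
    (hle : smallGenSet K a d b ⊆ RingHom.ker (phib K a d b)) :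
    RingHom.ker (phib K a d b) = Ideal.span (smallGenSet K a d b) := by
  have hle' := Ideal.span_le.2 hle
  refine le_antisymm (fun g hg => ?_) hle'
  obtain ⟨N, hN⟩ := exists_FF g
  refine mem_of_dvd hI hle' (fun N _ g hg hF => ?_) (fun g hg hF => ?_) N g hg hN
  · exact dvd_of_ker K a d b (by omega) (by omega) N g hg hF
  · exact mem_of_base K a d b _ hI g hg hF

end Final

/-- For `b ∈ {1,2}`, the kernel `E_b` of `φ_b` is generated by
`{A(i;b,j)} ∪ {L(0), L(1), D}` together with `{Q(1,1), Q(1,2)}` when `b = 1`, respectively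
`{Q(2,1)}` when `b = 2` (the generators `B(i,j)` are redundant). -/
theorem kernel_eq_small_gen_set (K : Type) [Field K] (a d b : ℕ)
    (hb : b = 1 ∨ b = 2) (ha : 1 ≤ a) (hd : 1 ≤ d)
    (hgcd : Nat.gcd (3 * a + b) d = 1)
    (hmin : ∀ i : Fin 4, (3 * a + b + (i : ℕ) * d) ∉
      AddSubmonoid.closure {x : ℕ | ∃ j : Fin 4, j ≠ i ∧ x = 3 * a + b + (j : ℕ) * d}) :
    RingHom.ker (phib K a d b) = Ideal.span (smallGenSet K a d b) := by
  rcases hb with rfl | rfl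
  · exact ker_eq_of_good K a d 1 (Or.inl rfl) (good_one K a d) (ker_one K a d ha)
  · exact ker_eq_of_good K a d 2 (Or.inr rfl) (good_two K a d) (ker_two K a d ha)
end
end
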